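/- The total variation distance between ν^T_n (the distribution of the pair of trees of a uniformly random tanglegram of size n) and ν^P_n (the distribution of the isomorphism classes of two independent uniformly random plane binary trees with n leaves) satisfies d(ν^T_n, ν^P_n) = O(n^{-1/2}) as n → ∞. -/

import Mathlib

open scoped Classical

inductive PTree : Type
  | leaf : PTree
  | node : PTree → PTree → PTree
deriving DecidableEq

namespace PTree

def size : PTree → ℕ
  | leaf => 1
  | node l r => size l + size r

def cherries : PTree → ℕ
  | leaf => 0
  | node leaf leaf => 1
  | node l r => cherries l + cherries r

def height : PTree → ℕ
  | leaf => 0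
  | node l r => max (height l) (height r) + 1

def encode : PTree → ℕ
  | leaf => 0
  | node l r => Nat.pair (encode l) (encode r) + 1

def normalize : PTree → PTree
  | leaf => leaf
  | node l r =>
      let l' := normalize l
      let r' := normalize r
      if encode l' ≤ encode r' then node l' r' else node r' l'

def isoFuns : PTree → PTree → List (ℕ → ℕ)
  | leaf, leaf => [fun i => i]
  | node l r, node l' r' =>
      ((isoFuns l l').flatMap fun g => (isoFuns r r').map fun h =>
        fun i => if i < l.size then g i else h (i - l.size) + l'.size)
      ++
      ((isoFuns l r').flatMap fun g => (isoFuns r l').map fun h =>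
        fun i => if i < l.size then g i + l'.size else h (i - l.size))
  | _, _ => []

def planeTrees : ℕ → Finset PTree
  | 0 => ∅
  | 1 => {leaf}
  | n + 2 =>
      (Finset.range (n + 1)).attach.biUnion fun k =>
        ((planeTrees (k.1 + 1)) ×ˢ (planeTrees (n + 1 - k.1))).image
          fun p => node p.1 p.2
  termination_by n => n
  decreasing_by
  · have := Finset.mem_range.mp k.2; omega
  · omega

def binTrees (n : ℕ) : Finset PTree := (planeTrees n).image normalize

/-- Triples (T, v, S): left plane tree, right plane tree, and a matching `v`
(a permutation of `0, …, n-1`, encoded as the list of its values) matching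
leaf `i` of `T` with leaf `v i` of `S`. -/
def Triples (n : ℕ) : Finset (PTree × PTree × List ℕ) :=
  (planeTrees n) ×ˢ ((planeTrees n) ×ˢ (List.range n).permutations.toFinset)

/-- Two triples represent the same tanglegram iff there are isomorphisms of the left
trees and of the right trees compatible with the matchings. -/
def equivTriple (n : ℕ) (t t' : PTree × PTree × List ℕ) : Bool :=
  (isoFuns t.1 t'.1).any fun φ => (isoFuns t.2.1 t'.2.1).any fun ψ =>
    (List.range n).all fun i => t'.2.2.getD (φ i) 0 == ψ (t.2.2.getD i 0)

/-- The tanglegrams of size `n`: equivalence classes of triples. -/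
def tangleClasses (n : ℕ) : Finset (Finset (PTree × PTree × List ℕ)) :=
  (Triples n).image fun t => (Triples n).filter (fun t' => equivTriple n t t' = true)

/-- The number of tanglegrams of size `n`. -/
def numTanglegrams (n : ℕ) : ℕ := (tangleClasses n).card

/-- The probability that a uniformly random tanglegram of size `n` satisfies the
(isomorphism-invariant) property `P` of triples. -/
noncomputable def tangleProb (n : ℕ) (P : PTree × PTree × List ℕ → Prop) : ℝ :=
  ((tangleClasses n).filter fun c => ∃ t ∈ c, P t).card / numTanglegrams n

/-- The expectation of the statistic `f` of a uniformly random tanglegram of size `n`. -/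
noncomputable def tangleExp (n : ℕ) (f : PTree × PTree × List ℕ → ℕ) : ℝ :=
  ∑' k : ℕ, (k : ℝ) * tangleProb n (fun t => f t = k)

end PTree

namespace PTree

/-- The distribution on pairs of binary trees (canonical representatives) induced by
the two halves of a uniformly random tanglegram of size `n`:
probability that the pair of isomorphism classes of the two trees lies in `S`. -/
noncomputable def nuT (n : ℕ) (S : Finset (PTree × PTree)) : ℝ :=
  tangleProb n fun t => (normalize t.1, normalize t.2.1) ∈ S

/-- The distribution on pairs of binary trees induced by two independent uniformly
random plane binary trees with `n` leaves. -/
noncomputable def nuP (n : ℕ) (S : Finset (PTree × PTree)) : ℝ :=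
  (((planeTrees n) ×ˢ (planeTrees n)).filter
      fun p => (normalize p.1, normalize p.2) ∈ S).card / ((planeTrees n).card ^ 2 : ℝ)

/-- The total variation distance between `nuT` and `nuP`. -/
noncomputable def tvDist (n : ℕ) : ℝ :=
  ((binTrees n ×ˢ binTrees n).powerset).sup' (Finset.powerset_nonempty _)
    fun S => |nuT n S - nuP n S|

/-- The number of occurrences of (trees isomorphic to) `B` as a fringe subtree of `T`. -/
def occ (B : PTree) : PTree → ℕ
  | leaf => if normalize leaf = normalize B then 1 else 0
  | node l r => (if normalize (node l r) = normalize B then 1 else 0) + occ B l + occ B r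

/-- The number of generators of the automorphism group of `T`: the number of internal
vertices whose two branches are isomorphic. -/
def gens : PTree → ℕ
  | leaf => 0
  | node l r => (if normalize l = normalize r then 1 else 0) + gens l + gens r

/-- `T` has a root branch isomorphic to `B`. -/
def hasBranch (B : PTree) : PTree → Prop
  | leaf => False
  | node l r => normalize l = normalize B ∨ normalize r = normalize B

/-- The cherries of a plane binary tree whose leaves are numbered from `k` on
(left to right), as pairs of leaf positions. -/
def cherryList : PTree → ℕ → List (ℕ × ℕ)
  | leaf, _ => []
  | node leaf leaf, k => [(k, k + 1)]
  | node l r, k => cherryList l k ++ cherryList r (k + l.size)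

/-- The number of matched cherries: cherries of `T` whose two leaves are matched by `L`
to the two leaves of a cherry of `S`. -/
def matchedCherries (T S : PTree) (L : List ℕ) : ℕ :=
  (cherryList T 0).countP fun p =>
    (cherryList S 0).any fun q =>
      (L.getD p.1 0 == q.1 && L.getD p.2 0 == q.2) ||
      (L.getD p.1 0 == q.2 && L.getD p.2 0 == q.1)

/-- The number of automorphisms of the tanglegram represented by the triple `(T, L, S)`:
pairs of automorphisms of the two trees compatible with the matching `L`. -/
def tangleAutCount (T S : PTree) (L : List ℕ) : ℕ :=
  ((isoFuns T T).map fun a =>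
    (isoFuns S S).countP fun b =>
      (List.range T.size).all fun i => L.getD (a i) 0 == b (L.getD i 0)).sum

/-- The number of automorphisms of `T` whose cycle type is `μ(s) = 2^s 1^(n-2s)`,
i.e. involutions of the leaves moving exactly `2 s` leaves. -/
def autMuCount (T : PTree) (s : ℕ) : ℕ :=
  (isoFuns T T).countP fun f =>
    ((List.range T.size).all fun i => f (f i) == i) &&
    ((List.range T.size).countP fun i => !(f i == i)) == 2 * s

end PTree

namespace PTree

/-- The type of leaves of a plane binary tree. -/
def Leaves : PTree → Type
  | leaf => Unit
  | node l r => Leaves l ⊕ Leaves r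

noncomputable instance fintypeLeaves : (T : PTree) → Fintype (Leaves T)
  | leaf => inferInstanceAs (Fintype Unit)
  | node l r =>
      letI := fintypeLeaves l
      letI := fintypeLeaves r
      inferInstanceAs (Fintype (Leaves l ⊕ Leaves r))

instance nonemptyLeaves : (T : PTree) → Nonempty (Leaves T)
  | leaf => inferInstanceAs (Nonempty Unit)
  | node l r =>
      letI := nonemptyLeaves l
      inferInstanceAs (Nonempty (Leaves l ⊕ Leaves r))

/-- The type of root-preserving isomorphisms between two plane binary trees. -/
def Iso : PTree → PTree → Type
  | leaf, leaf => Unit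
  | node l r, node l' r' => (Iso l l' × Iso r r') ⊕ (Iso l r' × Iso r l')
  | leaf, node _ _ => Empty
  | node _ _, leaf => Empty

noncomputable instance fintypeIso : (T T' : PTree) → Fintype (Iso T T')
  | leaf, leaf => inferInstanceAs (Fintype Unit)
  | node l r, node l' r' =>
      letI := fintypeIso l l'
      letI := fintypeIso r r'
      letI := fintypeIso l r'
      letI := fintypeIso r l'
      inferInstanceAs (Fintype ((Iso l l' × Iso r r') ⊕ (Iso l r' × Iso r l')))
  | leaf, node _ _ => inferInstanceAs (Fintype Empty)
  | node _ _, leaf => inferInstanceAs (Fintype Empty)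

/-- The bijection between leaves underlying an isomorphism. -/
def Iso.toEquiv : {T T' : PTree} → Iso T T' → (Leaves T ≃ Leaves T')
  | leaf, leaf, _ => Equiv.refl Unit
  | node _ _, node _ _, Sum.inl p => Equiv.sumCongr p.1.toEquiv p.2.toEquiv
  | node _ _, node _ _, Sum.inr p =>
      (Equiv.sumCongr p.1.toEquiv p.2.toEquiv).trans (Equiv.sumComm _ _)

theorem Iso.toEquiv_injective : {T T' : PTree} →
    Function.Injective (Iso.toEquiv : Iso T T' → (Leaves T ≃ Leaves T'))
  | leaf, leaf => fun _ _ _ => rfl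
  | leaf, node _ _ => fun x => x.elim
  | node _ _, leaf => fun x => x.elim
  | node l r, node l' r' => by
    obtain ⟨x₀⟩ := nonemptyLeaves l
    have h1 : Function.Injective (Iso.toEquiv : Iso l l' → _) := Iso.toEquiv_injective
    have h2 : Function.Injective (Iso.toEquiv : Iso r r' → _) := Iso.toEquiv_injective
    have h3 : Function.Injective (Iso.toEquiv : Iso l r' → _) := Iso.toEquiv_injective
    have h4 : Function.Injective (Iso.toEquiv : Iso r l' → _) := Iso.toEquiv_injective
    rintro (⟨g, h⟩ | ⟨g, h⟩) (⟨g', h'⟩ | ⟨g', h'⟩) H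
    · have hg : g = g' := h1 (Equiv.ext fun x => Sum.inl_injective
        (congrArg (fun e : Leaves l ⊕ Leaves r ≃ Leaves l' ⊕ Leaves r' => e (Sum.inl x)) H))
      have hh : h = h' := h2 (Equiv.ext fun x => Sum.inr_injective
        (congrArg (fun e : Leaves l ⊕ Leaves r ≃ Leaves l' ⊕ Leaves r' => e (Sum.inr x)) H))
      rw [hg, hh]
    · have := congrArg
        (fun e : Leaves l ⊕ Leaves r ≃ Leaves l' ⊕ Leaves r' => e (Sum.inl x₀)) H
      cases this
    · have := congrArg
        (fun e : Leaves l ⊕ Leaves r ≃ Leaves l' ⊕ Leaves r' => e (Sum.inl x₀)) H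
      cases this
    · have hg : g = g' := h3 (Equiv.ext fun x => Sum.inr_injective
        (congrArg (fun e : Leaves l ⊕ Leaves r ≃ Leaves l' ⊕ Leaves r' => e (Sum.inl x)) H))
      have hh : h = h' := h4 (Equiv.ext fun x => Sum.inl_injective
        (congrArg (fun e : Leaves l ⊕ Leaves r ≃ Leaves l' ⊕ Leaves r' => e (Sum.inr x)) H))
      rw [hg, hh]

theorem Iso.exists_refl : (T : PTree) → ∃ e : Iso T T, e.toEquiv = Equiv.refl _
  | leaf => ⟨(), rfl⟩
  | node l r => by
    obtain ⟨g, hg⟩ := Iso.exists_refl l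
    obtain ⟨h, hh⟩ := Iso.exists_refl r
    refine ⟨Sum.inl (g, h), ?_⟩
    ext (x | x) <;> simp only [Iso.toEquiv, hg, hh] <;> rfl

theorem Iso.exists_symm : {T T' : PTree} → (e : Iso T T') →
    ∃ e' : Iso T' T, e'.toEquiv = e.toEquiv.symm
  | leaf, leaf, _ => ⟨(), rfl⟩
  | node _ _, node _ _, Sum.inl (g, h) => by
    obtain ⟨g', hg⟩ := Iso.exists_symm g
    obtain ⟨h', hh⟩ := Iso.exists_symm h
    refine ⟨Sum.inl (g', h'), ?_⟩
    ext (x | x) <;> simp only [Iso.toEquiv, hg, hh] <;> rfl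
  | node _ _, node _ _, Sum.inr (g, h) => by
    obtain ⟨g', hg⟩ := Iso.exists_symm g
    obtain ⟨h', hh⟩ := Iso.exists_symm h
    refine ⟨Sum.inr (h', g'), ?_⟩
    ext (x | x) <;> simp only [Iso.toEquiv, hg, hh] <;> rfl

theorem Iso.exists_trans : {T T' T'' : PTree} → (e : Iso T T') → (e' : Iso T' T'') →
    ∃ e'' : Iso T T'', e''.toEquiv = e.toEquiv.trans e'.toEquiv
  | leaf, leaf, leaf, _, _ => ⟨(), rfl⟩
  | node _ _, node _ _, node _ _, Sum.inl (g, h), Sum.inl (g', h') => by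
    obtain ⟨g'', hg⟩ := Iso.exists_trans g g'
    obtain ⟨h'', hh⟩ := Iso.exists_trans h h'
    refine ⟨Sum.inl (g'', h''), ?_⟩
    ext (x | x) <;> simp only [Iso.toEquiv, hg, hh] <;> rfl
  | node _ _, node _ _, node _ _, Sum.inl (g, h), Sum.inr (g', h') => by
    obtain ⟨g'', hg⟩ := Iso.exists_trans g g'
    obtain ⟨h'', hh⟩ := Iso.exists_trans h h'
    refine ⟨Sum.inr (g'', h''), ?_⟩
    ext (x | x) <;> simp only [Iso.toEquiv, hg, hh] <;> rfl
  | node _ _, node _ _, node _ _, Sum.inr (g, h), Sum.inl (g', h') => by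
    obtain ⟨g'', hg⟩ := Iso.exists_trans g h'
    obtain ⟨h'', hh⟩ := Iso.exists_trans h g'
    refine ⟨Sum.inr (g'', h''), ?_⟩
    ext (x | x) <;> simp only [Iso.toEquiv, hg, hh] <;> rfl
  | node _ _, node _ _, node _ _, Sum.inr (g, h), Sum.inr (g', h') => by
    obtain ⟨g'', hg⟩ := Iso.exists_trans g h'
    obtain ⟨h'', hh⟩ := Iso.exists_trans h g'
    refine ⟨Sum.inl (g'', h''), ?_⟩
    ext (x | x) <;> simp only [Iso.toEquiv, hg, hh] <;> rfl

theorem size_pos : (T : PTree) → 0 < T.size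
  | leaf => Nat.one_pos
  | node l _ => Nat.add_pos_left (size_pos l) _

/-- The left-to-right numbering of the leaves. -/
def num : (T : PTree) → (Leaves T ≃ Fin T.size)
  | leaf => (Equiv.ofUnique Unit (Fin 1))
  | node l r => (Equiv.sumCongr (num l) (num r)).trans finSumFinEquiv

/-- The index of a leaf in the left-to-right numbering. -/
def idx {T : PTree} (x : Leaves T) : ℕ := (num T x : ℕ)

theorem idx_inl {l r : PTree} (x : Leaves l) :
    idx (T := node l r) (Sum.inl x) = idx x := rfl

theorem idx_inr {l r : PTree} (x : Leaves r) :
    idx (T := node l r) (Sum.inr x) = l.size + idx x := rfl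

theorem idx_lt {T : PTree} (x : Leaves T) : idx x < T.size := (num T x).isLt

theorem idx_injective {T : PTree} : Function.Injective (idx : Leaves T → ℕ) :=
  fun _ _ h => (num T).injective (Fin.ext h)

theorem card_leaves (T : PTree) : Fintype.card (Leaves T) = T.size := by
  rw [Fintype.card_congr (num T), Fintype.card_fin]

theorem Iso.size_eq {T T' : PTree} (e : Iso T T') : T.size = T'.size := by
  rw [← card_leaves, ← card_leaves, Fintype.card_congr e.toEquiv]

theorem exists_mem_isoFuns : {T T' : PTree} → (e : Iso T T') →
    ∃ f ∈ isoFuns T T', ∀ x, f (idx x) = idx (e.toEquiv x)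
  | leaf, leaf, _ => ⟨fun i => i, by simp [isoFuns], fun _ => rfl⟩
  | node l r, node l' r', Sum.inl (g, h) => by
    obtain ⟨f₁, hf₁, h₁⟩ := exists_mem_isoFuns g
    obtain ⟨f₂, hf₂, h₂⟩ := exists_mem_isoFuns h
    refine ⟨fun i => if i < l.size then f₁ i else f₂ (i - l.size) + l'.size, ?_, ?_⟩
    · simp only [isoFuns, List.mem_append, List.mem_flatMap, List.mem_map]
      exact Or.inl ⟨f₁, hf₁, f₂, hf₂, rfl⟩
    · rintro (x | x)
      · simp [idx_inl, idx_lt, h₁]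
        exact (idx_inl (r := r') (g.toEquiv x)).symm
      · simp [idx_inr, h₂, add_comm]
        exact (idx_inr (l := l') (h.toEquiv x)).symm
  | node l r, node l' r', Sum.inr (g, h) => by
    obtain ⟨f₁, hf₁, h₁⟩ := exists_mem_isoFuns g
    obtain ⟨f₂, hf₂, h₂⟩ := exists_mem_isoFuns h
    refine ⟨fun i => if i < l.size then f₁ i + l'.size else f₂ (i - l.size), ?_, ?_⟩
    · simp only [isoFuns, List.mem_append, List.mem_flatMap, List.mem_map]
      exact Or.inr ⟨f₁, hf₁, f₂, hf₂, rfl⟩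
    · rintro (x | x)
      · simp [idx_inl, idx_lt, h₁, add_comm]
        exact (idx_inr (l := l') (g.toEquiv x)).symm
      · simp [idx_inr, h₂]
        exact (idx_inl (r := r') (h.toEquiv x)).symm

theorem exists_iso_of_mem_isoFuns : {T T' : PTree} → {f : ℕ → ℕ} → f ∈ isoFuns T T' →
    ∃ e : Iso T T', ∀ x, f (idx x) = idx (e.toEquiv x)
  | leaf, leaf, f, hf => by
    simp only [isoFuns, List.mem_singleton] at hf
    subst hf
    exact ⟨(), fun _ => rfl⟩
  | leaf, node _ _, f, hf => by simp [isoFuns] at hf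
  | node _ _, leaf, f, hf => by simp [isoFuns] at hf
  | node l r, node l' r', f, hf => by
    simp only [isoFuns, List.mem_append, List.mem_flatMap, List.mem_map] at hf
    rcases hf with ⟨f₁, hf₁, f₂, hf₂, rfl⟩ | ⟨f₁, hf₁, f₂, hf₂, rfl⟩
    · obtain ⟨g, h₁⟩ := exists_iso_of_mem_isoFuns hf₁
      obtain ⟨h, h₂⟩ := exists_iso_of_mem_isoFuns hf₂
      refine ⟨Sum.inl (g, h), ?_⟩
      rintro (x | x)
      · simp [idx_inl, idx_lt, h₁]
        exact (idx_inl (r := r') (g.toEquiv x)).symm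
      · simp [idx_inr, h₂, add_comm]
        exact (idx_inr (l := l') (h.toEquiv x)).symm
    · obtain ⟨g, h₁⟩ := exists_iso_of_mem_isoFuns hf₁
      obtain ⟨h, h₂⟩ := exists_iso_of_mem_isoFuns hf₂
      refine ⟨Sum.inr (g, h), ?_⟩
      rintro (x | x)
      · simp [idx_inl, idx_lt, h₁, add_comm]
        exact (idx_inr (l := l') (g.toEquiv x)).symm
      · simp [idx_inr, h₂]
        exact (idx_inl (r := r') (h.toEquiv x)).symm

theorem encode_injective : Function.Injective encode := by
  intro T
  induction T with
  | leaf =>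
    intro T' h
    cases T' with
    | leaf => rfl
    | node l r => simp [encode] at h
  | node l r ihl ihr =>
    intro T' h
    cases T' with
    | leaf => simp [encode] at h
    | node l' r' =>
      simp only [encode, Nat.add_right_cancel_iff, Nat.pair_eq_pair] at h
      rw [ihl h.1, ihr h.2]

theorem normalize_node_comm (l r : PTree) : normalize (node l r) = normalize (node r l) := by
  simp only [normalize]
  split_ifs with h1 h2 h2
  · rw [encode_injective (le_antisymm h1 h2)]
  · rfl
  · rfl
  · omega

theorem normalize_node_congr {l r l' r' : PTree} (hl : normalize l = normalize l')
    (hr : normalize r = normalize r') : normalize (node l r) = normalize (node l' r') := by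
  simp only [normalize, hl, hr]

theorem Iso.normalize_eq : {T T' : PTree} → Iso T T' → normalize T = normalize T'
  | leaf, leaf, _ => rfl
  | node _ _, node _ _, Sum.inl (g, h) => normalize_node_congr g.normalize_eq h.normalize_eq
  | node _ _, node _ _, Sum.inr (g, h) =>
      (normalize_node_congr g.normalize_eq h.normalize_eq).trans (normalize_node_comm _ _)

end PTree

namespace PTree

open Finset

theorem mem_planeTrees {n : ℕ} {T : PTree} : T ∈ planeTrees n ↔ T.size = n := by
  induction n using Nat.strong_induction_on generalizing T with
  | _ n ih =>
    match n, ih with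
    | 0, _ => simpa [planeTrees] using (size_pos T).ne'
    | 1, _ =>
      cases T with
      | leaf => simp [planeTrees, size]
      | node l r =>
        have := size_pos l
        have := size_pos r
        simp [planeTrees, size]
        omega
    | n + 2, ih =>
      rw [planeTrees]
      simp only [mem_biUnion, mem_attach, true_and, Subtype.exists, mem_range, mem_image,
        mem_product, Prod.exists]
      constructor
      · rintro ⟨k, hk, l, r, ⟨hl, hr⟩, rfl⟩
        rw [ih _ (by omega)] at hl hr
        simp only [size]
        omega
      · intro h
        cases T with
        | leaf => simp [size] at h
        | node l r =>
          have h1 := size_pos l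
          have h2 := size_pos r
          simp only [size] at h
          refine ⟨l.size - 1, by omega, l, r, ⟨?_, ?_⟩, rfl⟩
          · rw [ih _ (by omega)]; omega
          · rw [ih _ (by omega)]; omega

theorem sum_planeTrees {M : Type*} [AddCommMonoid M] (n : ℕ) (f : PTree → M) :
    ∑ T ∈ planeTrees n, f T = (if n = 1 then f leaf else 0) +
      ∑ p ∈ antidiagonal n, ∑ l ∈ planeTrees p.1, ∑ r ∈ planeTrees p.2, f (node l r) := by
  have h1 : planeTrees n = ((planeTrees n).filter (· = leaf)) ∪
      (((antidiagonal n).sigma fun p => planeTrees p.1 ×ˢ planeTrees p.2).image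
        fun q => node q.2.1 q.2.2) := by
    ext T
    cases T with
    | leaf => simp
    | node l r => simp [mem_planeTrees, size]
  rw [h1, sum_union, sum_image, sum_sigma]
  · congr 1
    · by_cases hn : n = 1
      · subst hn
        simp [planeTrees, filter_singleton]
      · rw [if_neg hn]
        apply sum_eq_zero
        intro T hT
        simp only [mem_filter, mem_planeTrees] at hT
        obtain ⟨h, rfl⟩ := hT
        exact absurd h.symm hn
    · exact sum_congr rfl fun p _ => sum_product _ _ _
  · rintro ⟨⟨i, j⟩, l, r⟩ h ⟨⟨i', j'⟩, l', r'⟩ h' H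
    simp only [coe_sigma, Set.mem_sigma_iff, mem_coe, mem_product, mem_planeTrees] at h h'
    simp only [node.injEq] at H
    obtain ⟨rfl, rfl⟩ := H
    obtain ⟨-, rfl, rfl⟩ := h
    obtain ⟨-, rfl, rfl⟩ := h'
    rfl
  · rw [disjoint_left]
    intro T hT hT'
    simp only [mem_filter] at hT
    simp only [mem_image] at hT'
    obtain ⟨q, -, hq⟩ := hT'
    rw [hT.2] at hq
    cases hq

/-- The number of plane binary trees with `n` leaves. -/
def numTrees (n : ℕ) : ℕ := (planeTrees n).card

theorem numTrees_zero : numTrees 0 = 0 := by simp [numTrees, planeTrees]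

theorem numTrees_rec (n : ℕ) : numTrees n = (if n = 1 then 1 else 0) +
    ∑ p ∈ antidiagonal n, numTrees p.1 * numTrees p.2 := by
  simp only [numTrees, card_eq_sum_ones]
  rw [sum_planeTrees]
  simp

theorem numTrees_succ (n : ℕ) : numTrees (n + 1) = catalan n := by
  induction n using Nat.strong_induction_on with
  | _ n ih =>
    rw [numTrees_rec]
    cases n with
    | zero => simp [numTrees_zero, Nat.antidiagonal_succ]
    | succ n =>
      rw [catalan_succ', Nat.antidiagonal_succ_succ']
      simp only [sum_cons, sum_map, numTrees_zero]
      simp only [zero_mul, Nat.add_eq_right, Nat.add_eq_zero_iff, one_ne_zero, and_false,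
        if_false, zero_add, mul_zero]
      apply sum_congr rfl
      intro p hp
      rw [HasAntidiagonal.mem_antidiagonal] at hp
      simp only [Function.Embedding.prodMap, Function.Embedding.coeFn_mk, Prod.map]
      rw [ih _ (by omega), ih _ (by omega)]

theorem numTrees_pos {n : ℕ} (hn : 0 < n) : 0 < numTrees n := by
  obtain ⟨n, rfl⟩ := Nat.exists_eq_succ_of_ne_zero hn.ne'
  rw [Nat.succ_eq_add_one, numTrees_succ, catalan_eq_centralBinom_div]
  exact Nat.div_pos (Nat.le_of_dvd (Nat.centralBinom_pos n) n.succ_dvd_centralBinom) n.succ_pos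

theorem numTrees_succ_mul (n : ℕ) (hn : 0 < n) :
    (n + 1) * numTrees (n + 1) = 2 * (2 * n - 1) * numTrees n := by
  obtain ⟨n, rfl⟩ := Nat.exists_eq_succ_of_ne_zero hn.ne'
  rw [Nat.succ_eq_add_one, numTrees_succ, numTrees_succ]
  have h1 := succ_mul_catalan_eq_centralBinom (n + 1)
  have h2 := succ_mul_catalan_eq_centralBinom n
  have h3 := Nat.succ_mul_centralBinom_succ n
  rw [← h1, ← h2] at h3
  have : 2 * (n + 1) - 1 = 2 * n + 1 := by omega
  rw [this]
  apply Nat.eq_of_mul_eq_mul_left n.succ_pos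
  rw [Nat.succ_eq_add_one]
  linarith

theorem numTrees_le_pow (n : ℕ) : numTrees (n + 1) ≤ 4 ^ n := by
  induction n with
  | zero => simp [numTrees_succ]
  | succ n ih =>
    have h := numTrees_succ_mul (n + 1) n.succ_pos
    have h2 : (n + 1 + 1) * numTrees (n + 1 + 1) ≤ (n + 1 + 1) * (4 * numTrees (n + 1)) := by
      rw [h, ← mul_assoc]
      exact Nat.mul_le_mul_right _ (by omega)
    have := Nat.le_of_mul_le_mul_left h2 (by omega)
    calc _ ≤ _ := this
      _ ≤ 4 * 4 ^ n := by omega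
      _ = _ := by ring

theorem numTrees_mono : Monotone numTrees := by
  refine monotone_nat_of_le_succ fun n => ?_
  rcases Nat.eq_zero_or_pos n with rfl | hn
  · simp [numTrees_zero]
  · have h := numTrees_succ_mul n hn
    have h2 : (n + 1) * numTrees n ≤ (n + 1) * numTrees (n + 1) := by
      rw [h]
      exact Nat.mul_le_mul_right _ (by omega)
    exact Nat.le_of_mul_le_mul_left h2 (by omega)

theorem sum_card_iso (T : PTree) (k : ℕ) :
    ∑ T' ∈ planeTrees k, Fintype.card (Iso T T') =
      if k = T.size then 2 ^ (T.size - 1) else 0 := by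
  induction T generalizing k with
  | leaf =>
    rw [sum_planeTrees]
    have h0 : ∀ l r : PTree, Fintype.card (Iso leaf (node l r)) = 0 := fun l r =>
      Fintype.card_eq_zero_iff.mpr (inferInstanceAs (IsEmpty Empty))
    have h1 : Fintype.card (Iso leaf leaf) = 1 := Fintype.card_unit
    simp [h0, h1, size]
  | node l r ihl ihr =>
    rw [sum_planeTrees]
    have h0 : Fintype.card (Iso (node l r) leaf) = 0 :=
      Fintype.card_eq_zero_iff.mpr (inferInstanceAs (IsEmpty Empty))
    have h1 : ∀ l' r' : PTree, Fintype.card (Iso (node l r) (node l' r')) =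
        Fintype.card (Iso l l') * Fintype.card (Iso r r') +
        Fintype.card (Iso l r') * Fintype.card (Iso r l') := by
      intro l' r'
      rw [← Fintype.card_prod, ← Fintype.card_prod, ← Fintype.card_sum]
      exact Fintype.card_congr (Equiv.refl _)
    have h2 : ∀ p : ℕ × ℕ, ∑ l' ∈ planeTrees p.1, ∑ r' ∈ planeTrees p.2,
        Fintype.card (Iso (node l r) (node l' r')) =
        (if p = (l.size, r.size) then 2 ^ (l.size - 1) * 2 ^ (r.size - 1) else 0) +
        (if p = (r.size, l.size) then 2 ^ (l.size - 1) * 2 ^ (r.size - 1) else 0) := by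
      rintro ⟨i, j⟩
      simp only [h1, sum_add_distrib]
      congr 1
      · rw [← sum_mul_sum, ihl, ihr]
        simp only [Prod.mk.injEq]
        split_ifs <;> simp_all
      · rw [sum_comm, ← sum_mul_sum, ihl, ihr]
        simp only [Prod.mk.injEq]
        split_ifs <;> simp_all
    simp only [h0, h2, sum_add_distrib, sum_ite_eq', HasAntidiagonal.mem_antidiagonal, ite_self, zero_add]
    have hs : (node l r).size = l.size + r.size := rfl
    have hl := size_pos l
    have hr := size_pos r
    have h3 : l.size + r.size - 1 = (l.size - 1) + (r.size - 1) + 1 := by omega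
    rw [hs, add_comm r.size l.size, h3, pow_add, pow_add]
    by_cases hk : l.size + r.size = k
    · rw [if_pos hk, if_pos hk.symm]
      ring
    · simp [hk, Ne.symm hk]

end PTree

namespace PTree

open Finset

theorem card_image_filter_class {α : Type*} (s : Finset α) (r : α → α → Prop)
    (hr : ∀ a ∈ s, r a a) (hs : ∀ a ∈ s, ∀ b ∈ s, r a b → r b a)
    (ht : ∀ a ∈ s, ∀ b ∈ s, ∀ c ∈ s, r a b → r b c → r a c)
    (P : α → Prop) (hP : ∀ a ∈ s, ∀ b ∈ s, r a b → P a → P b) :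
    ((((s.image fun a => s.filter (r a)).filter fun c => ∃ a ∈ c, P a).card : ℕ) : ℝ) =
      ∑ a ∈ s.filter P, (1 : ℝ) / (s.filter (r a)).card := by
  have key : ∀ a ∈ s, ∀ b ∈ s, (s.filter (r a) = s.filter (r b) ↔ r a b) := by
    intro a ha b hb
    constructor
    · intro h
      have : b ∈ s.filter (r b) := mem_filter.mpr ⟨hb, hr b hb⟩
      rw [← h] at this
      exact (mem_filter.mp this).2
    · intro h
      ext c
      simp only [mem_filter, and_congr_right_iff]
      exact fun hc => ⟨fun h' => ht b hb a ha c hc (hs a ha b hb h) h',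
        fun h' => ht a ha b hb c hc h h'⟩
  rw [← sum_fiberwise_of_maps_to (s := s.filter P) (g := fun a => s.filter (r a))
    (t := (s.image fun a => s.filter (r a)).filter fun c => ∃ a ∈ c, P a), card_eq_sum_ones,
    Nat.cast_sum]
  · apply sum_congr rfl
    intro c hc
    simp only [mem_filter, mem_image] at hc
    obtain ⟨⟨a, ha, rfl⟩, b, hb, hPb⟩ := hc
    rw [mem_filter] at hb
    have hPa := hP b hb.1 a ha (hs a ha b hb.1 hb.2) hPb
    have h1 : (s.filter P).filter (fun x => s.filter (r x) = s.filter (r a)) =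
        s.filter (r a) := by
      ext x
      simp only [mem_filter]
      constructor
      · rintro ⟨⟨hx, -⟩, h⟩
        exact ⟨hx, hs x hx a ha ((key x hx a ha).mp h)⟩
      · rintro ⟨hx, h⟩
        exact ⟨⟨hx, hP a ha x hx h hPa⟩, (key x hx a ha).mpr (hs a ha x hx h)⟩
    rw [h1, sum_congr rfl (g := fun _ => (1 : ℝ) / (s.filter (r a)).card)]
    · have : ((s.filter (r a)).card : ℝ) ≠ 0 := by
        rw [Nat.cast_ne_zero, ← Nat.pos_iff_ne_zero, card_pos]
        exact ⟨b, mem_filter.mpr hb⟩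
      rw [sum_const, nsmul_eq_mul]
      field_simp
      simp
    · intro x hx
      rw [mem_filter] at hx
      rw [(key x hx.1 a ha).mpr (hs a ha x hx.1 hx.2)]
  · intro a ha
    rw [mem_filter] at ha
    simp only [mem_filter, mem_image]
    exact ⟨⟨a, ha.1, rfl⟩, a, ⟨ha.1, hr a ha.1⟩, ha.2⟩

/-- The list of values of a matching between the leaves of two trees. -/
def code {T S : PTree} (v : Leaves T ≃ Leaves S) : List ℕ :=
  List.ofFn fun i : Fin T.size => idx (v ((num T).symm i))

theorem code_getD {T S : PTree} (v : Leaves T ≃ Leaves S) (x : Leaves T) :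
    (code v).getD (idx x) 0 = idx (v x) := by
  have h : idx x < (code v).length := by simp [code, idx_lt]
  rw [List.getD_eq_getElem _ _ h]
  simp [code, idx]

theorem code_injective {T S : PTree} :
    Function.Injective (code : (Leaves T ≃ Leaves S) → List ℕ) := by
  intro v w h
  ext x
  apply idx_injective
  rw [← code_getD, h, code_getD]

theorem code_perm {T S : PTree} (v : Leaves T ≃ Leaves S) :
    (code v).Perm (List.range T.size) := by
  have hsz : T.size = S.size := by
    rw [← card_leaves, ← card_leaves, Fintype.card_congr v]
  rw [List.perm_ext_iff_of_nodup _ List.nodup_range]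
  · intro a
    simp only [code, List.mem_ofFn, List.mem_range]
    constructor
    · rintro ⟨i, rfl⟩
      exact (idx_lt _).trans_eq hsz.symm
    · intro ha
      rw [hsz] at ha
      exact ⟨num T (v.symm ((num S).symm ⟨a, ha⟩)), by simp [idx]⟩
  · exact List.nodup_ofFn.mpr
      (idx_injective.comp (v.injective.comp (num T).symm.injective))

theorem permutations_eq_image_code {n : ℕ} {T S : PTree} (hT : T.size = n) (hS : S.size = n) :
    (List.range n).permutations.toFinset =
      (univ : Finset (Leaves T ≃ Leaves S)).image code := by
  symm
  apply eq_of_subset_of_card_le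
  · intro L hL
    obtain ⟨v, -, rfl⟩ := mem_image.mp hL
    rw [List.mem_toFinset, List.mem_permutations, ← hT]
    exact code_perm v
  · have e : Leaves T ≃ Leaves S :=
      (num T).trans ((finCongr (hT.trans hS.symm)).trans (num S).symm)
    rw [card_image_of_injective _ code_injective, card_univ, Fintype.card_equiv e, card_leaves,
      hT]
    refine (List.toFinset_card_le _).trans ?_
    rw [List.length_permutations, List.length_range]

theorem sum_triples {M : Type*} [AddCommMonoid M] (n : ℕ)
    (F : PTree × PTree × List ℕ → M) :
    ∑ t ∈ Triples n, F t = ∑ T ∈ planeTrees n, ∑ S ∈ planeTrees n,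
      ∑ v : Leaves T ≃ Leaves S, F (T, S, code v) := by
  rw [Triples, sum_product]
  refine sum_congr rfl fun T hT => ?_
  rw [sum_product]
  refine sum_congr rfl fun S hS => ?_
  rw [permutations_eq_image_code (mem_planeTrees.mp hT) (mem_planeTrees.mp hS),
    sum_image fun _ _ _ _ h => code_injective h]

theorem mem_triples {n : ℕ} {t : PTree × PTree × List ℕ} (ht : t ∈ Triples n) :
    ∃ (T S : PTree) (v : Leaves T ≃ Leaves S), T.size = n ∧ S.size = n ∧
      t = (T, S, code v) := by
  obtain ⟨T, S, L⟩ := t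
  simp only [Triples, mem_product] at ht
  obtain ⟨hT, hS, hL⟩ := ht
  rw [mem_planeTrees] at hT hS
  rw [permutations_eq_image_code hT hS] at hL
  obtain ⟨v, -, rfl⟩ := mem_image.mp hL
  exact ⟨T, S, v, hT, hS, rfl⟩

theorem equivTriple_code {n : ℕ} {T S T' S' : PTree} (hT : T.size = n)
    (v : Leaves T ≃ Leaves S) (v' : Leaves T' ≃ Leaves S') :
    equivTriple n (T, S, code v) (T', S', code v') = true ↔
      ∃ (e : Iso T T') (e' : Iso S S'),
        e.toEquiv.trans v' = v.trans e'.toEquiv := by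
  simp only [equivTriple, List.any_eq_true, List.all_eq_true, List.mem_range, beq_iff_eq]
  constructor
  · rintro ⟨f, hf, g, hg, h⟩
    obtain ⟨e, he⟩ := exists_iso_of_mem_isoFuns hf
    obtain ⟨e', he'⟩ := exists_iso_of_mem_isoFuns hg
    refine ⟨e, e', Equiv.ext fun x => idx_injective ?_⟩
    have := h (idx x) (hT ▸ idx_lt x)
    rwa [he, code_getD, code_getD, he'] at this
  · rintro ⟨e, e', h⟩
    obtain ⟨f, hf, he⟩ := exists_mem_isoFuns e
    obtain ⟨g, hg, he'⟩ := exists_mem_isoFuns e'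
    refine ⟨f, hf, g, hg, fun i hi => ?_⟩
    obtain ⟨x, rfl⟩ : ∃ x : Leaves T, idx x = i :=
      ⟨(num T).symm ⟨i, hT ▸ hi⟩, by simp [idx]⟩
    rw [he, code_getD, code_getD, he']
    exact congrArg idx (Equiv.congr_fun h x)

/-- The number of pairs of isomorphisms intertwining two matchings. -/
noncomputable def intertwiners {T S T' S' : PTree} (v : Leaves T ≃ Leaves S)
    (v' : Leaves T' ≃ Leaves S') : ℕ :=
  ((univ : Finset (Iso T T' × Iso S S')).filter fun p =>
    p.1.toEquiv.trans v' = v.trans p.2.toEquiv).card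

theorem intertwiners_eq {T S T' S' : PTree} (v : Leaves T ≃ Leaves S)
    (v' : Leaves T' ≃ Leaves S') (e₀ : Iso T T') (e₀' : Iso S S')
    (h₀ : e₀.toEquiv.trans v' = v.trans e₀'.toEquiv) :
    intertwiners v v' = intertwiners v v := by
  choose tr htr using fun (A B C : PTree) (e : Iso A B) (e' : Iso B C) => Iso.exists_trans e e'
  obtain ⟨i, hi⟩ := e₀.exists_symm
  obtain ⟨i', hi'⟩ := e₀'.exists_symm
  have h1 : v' = e₀.toEquiv.symm.trans (v.trans e₀'.toEquiv) := by
    rw [← h₀, ← Equiv.trans_assoc, Equiv.symm_trans_self, Equiv.refl_trans]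
  refine card_bij' (fun p _ => (tr _ _ _ p.1 i, tr _ _ _ p.2 i'))
    (fun p _ => (tr _ _ _ p.1 e₀, tr _ _ _ p.2 e₀')) ?_ ?_ ?_ ?_
  · intro p hp
    simp only [mem_filter, mem_univ, true_and] at hp ⊢
    rw [htr, htr, hi, hi', ← Equiv.trans_assoc, ← hp, h1]
    ext x
    simp
  · intro p hp
    simp only [mem_filter, mem_univ, true_and] at hp ⊢
    rw [htr, htr, ← Equiv.trans_assoc, ← hp, h1]
    ext x
    simp
  · intro p _
    ext1 <;> apply Iso.toEquiv_injective <;> ext x <;> simp [htr, hi, hi']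
  · intro p _
    ext1 <;> apply Iso.toEquiv_injective <;> ext x <;> simp [htr, hi, hi']

theorem sum_intertwiners {n : ℕ} {T S : PTree} (hT : T.size = n) (hS : S.size = n)
    (v : Leaves T ≃ Leaves S) :
    ∑ T' ∈ planeTrees n, ∑ S' ∈ planeTrees n, ∑ v' : Leaves T' ≃ Leaves S',
      intertwiners v v' = 4 ^ (n - 1) := by
  have h : ∀ T' S' : PTree, ∑ v' : Leaves T' ≃ Leaves S', intertwiners v v' =
      Fintype.card (Iso T T') * Fintype.card (Iso S S') := by
    intro T' S'
    simp only [intertwiners, card_filter]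
    rw [sum_comm, ← Fintype.card_prod, Fintype.card_eq_sum_ones]
    refine sum_congr rfl fun p _ => ?_
    have : ∀ v' : Leaves T' ≃ Leaves S', (p.1.toEquiv.trans v' = v.trans p.2.toEquiv) ↔
        v' = p.1.toEquiv.symm.trans (v.trans p.2.toEquiv) := by
      intro v'
      constructor
      · intro h
        rw [← h, ← Equiv.trans_assoc, Equiv.symm_trans_self, Equiv.refl_trans]
      · rintro rfl
        rw [← Equiv.trans_assoc, Equiv.self_trans_symm, Equiv.refl_trans]
    simp [this]
  simp only [h, ← sum_mul_sum, sum_card_iso, hT, hS, if_true]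
  rw [← mul_pow]
  norm_num

theorem card_class_mul {n : ℕ} {T S : PTree} (hT : T.size = n) (hS : S.size = n)
    (v : Leaves T ≃ Leaves S) :
    ((Triples n).filter fun t' => equivTriple n (T, S, code v) t' = true).card *
      intertwiners v v = 4 ^ (n - 1) := by
  rw [card_filter, sum_triples, ← sum_intertwiners hT hS v, sum_mul]
  refine sum_congr rfl fun T' _ => ?_
  rw [sum_mul]
  refine sum_congr rfl fun S' _ => ?_
  rw [sum_mul]
  refine sum_congr rfl fun v' _ => ?_
  simp only [equivTriple_code hT]
  split_ifs with h
  · obtain ⟨e, e', h⟩ := h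
    rw [intertwiners_eq v v' e e' h, one_mul]
  · rw [zero_mul]
    symm
    rw [intertwiners, card_eq_zero, filter_eq_empty_iff]
    exact fun p _ hp => h ⟨p.1, p.2, hp⟩

/-- The number of triples (automorphism of `T`, automorphism of `S`, matching preserved by
both). -/
noncomputable def symCount (T S : PTree) : ℕ :=
  ∑ v : Leaves T ≃ Leaves S, intertwiners v v

theorem equivTriple_refl {n : ℕ} {t : PTree × PTree × List ℕ} (ht : t ∈ Triples n) :
    equivTriple n t t = true := by
  obtain ⟨T, S, v, hT, hS, rfl⟩ := mem_triples ht
  rw [equivTriple_code hT]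
  obtain ⟨e, he⟩ := Iso.exists_refl T
  obtain ⟨e', he'⟩ := Iso.exists_refl S
  exact ⟨e, e', by rw [he, he']; rfl⟩

theorem nonempty_of_mem_tangleClasses {n : ℕ} {c : Finset (PTree × PTree × List ℕ)}
    (hc : c ∈ tangleClasses n) : c.Nonempty := by
  obtain ⟨t, ht, rfl⟩ := mem_image.mp hc
  exact ⟨t, mem_filter.mpr ⟨ht, equivTriple_refl ht⟩⟩

theorem card_tangleClasses_filter (n : ℕ) (P : PTree × PTree → Prop)
    (hP : ∀ T S T' S' : PTree, Iso T T' → Iso S S' → P (T, S) → P (T', S')) :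
    ((((tangleClasses n).filter fun c => ∃ t ∈ c, P (t.1, t.2.1)).card : ℕ) : ℝ) =
      (∑ p ∈ (planeTrees n ×ˢ planeTrees n).filter P, (symCount p.1 p.2 : ℝ)) /
        4 ^ (n - 1) := by
  trans ∑ t ∈ (Triples n).filter fun t => P (t.1, t.2.1),
    (1 : ℝ) / ((Triples n).filter fun t' => equivTriple n t t' = true).card
  on_goal 1 =>
    rw [tangleClasses]
    convert card_image_filter_class (Triples n)
      (fun t t' => equivTriple n t t' = true) ?_ ?_ ?_ (fun t => P (t.1, t.2.1)) ?_
  rotate_right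
  · rw [sum_filter, sum_triples, sum_filter, sum_product, sum_div]
    refine sum_congr rfl fun T hT => ?_
    rw [sum_div]
    refine sum_congr rfl fun S hS => ?_
    rw [mem_planeTrees] at hT hS
    by_cases h : P (T, S)
    · simp only [h, if_true, symCount, Nat.cast_sum, sum_div]
      refine sum_congr rfl fun v _ => ?_
      have h1 := card_class_mul hT hS v
      have h2 : ((Triples n).filter fun t' =>
          equivTriple n (T, S, code v) t' = true).card ≠ 0 := by
        intro h0
        rw [h0, zero_mul] at h1
        exact (pow_pos (by norm_num : 0 < 4) _).ne h1
      rw [div_eq_div_iff (by exact_mod_cast h2) (by positivity), one_mul, mul_comm]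
      exact_mod_cast h1.symm
    · simp [h]
  · exact fun t ht => equivTriple_refl ht
  · intro t ht t' ht' h
    obtain ⟨T, S, v, hT, hS, rfl⟩ := mem_triples ht
    obtain ⟨T', S', v', hT', hS', rfl⟩ := mem_triples ht'
    rw [equivTriple_code hT] at h
    rw [equivTriple_code hT']
    obtain ⟨e, e', h⟩ := h
    obtain ⟨i, hi⟩ := e.exists_symm
    obtain ⟨i', hi'⟩ := e'.exists_symm
    refine ⟨i, i', ?_⟩
    rw [hi, hi']
    ext x
    have := Equiv.congr_fun h (e.toEquiv.symm x)
    simp only [Equiv.trans_apply, Equiv.apply_symm_apply] at this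
    simp [this]
  · intro t ht t' ht' t'' ht'' h h'
    obtain ⟨T, S, v, hT, hS, rfl⟩ := mem_triples ht
    obtain ⟨T', S', v', hT', hS', rfl⟩ := mem_triples ht'
    obtain ⟨T'', S'', v'', hT'', hS'', rfl⟩ := mem_triples ht''
    rw [equivTriple_code hT] at h
    rw [equivTriple_code hT'] at h'
    rw [equivTriple_code hT]
    obtain ⟨e, e', h⟩ := h
    obtain ⟨i, i', h'⟩ := h'
    obtain ⟨j, hj⟩ := Iso.exists_trans e i
    obtain ⟨j', hj'⟩ := Iso.exists_trans e' i'
    exact ⟨j, j', by rw [hj, hj', Equiv.trans_assoc, h', ← Equiv.trans_assoc, h,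
      Equiv.trans_assoc]⟩
  · intro t ht t' ht' h
    obtain ⟨T, S, v, hT, hS, rfl⟩ := mem_triples ht
    obtain ⟨T', S', v', hT', hS', rfl⟩ := mem_triples ht'
    rw [equivTriple_code hT] at h
    obtain ⟨e, e', -⟩ := h
    exact hP _ _ _ _ e e'

end PTree

section Matchings

open Finset Nat

theorem doubleFactorial_mono : Monotone Nat.doubleFactorial := by
  have key : ∀ n, n‼ ≤ (n + 1)‼ ∧ (n + 1)‼ ≤ (n + 2)‼ := by
    intro n
    induction n with
    | zero => simp [doubleFactorial]
    | succ n ih =>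
      refine ⟨ih.2, ?_⟩
      rw [doubleFactorial_add_two, doubleFactorial_add_two (n + 1)]
      exact Nat.mul_le_mul (by omega) ih.1
  exact monotone_nat_of_le_succ fun n => (key n).1

theorem multiset_prod_mul_count_factorial_le (M : Multiset ℕ) :
    (∀ a ∈ M, 2 ≤ a) → M.prod * ∏ a ∈ M.toFinset, (M.count a)! ≤ M.sum‼ := by
  induction M using Multiset.induction with
  | empty => simp
  | cons a M ih =>
    intro h
    have ih := ih fun b hb => h b (Multiset.mem_cons_of_mem hb)
    have ha : 2 ≤ a := h a (Multiset.mem_cons_self a M)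
    set K := (a ::ₘ M).toFinset with hK
    have haK : a ∈ K := by simp [hK]
    have h1 : ∏ b ∈ M.toFinset, (M.count b)! = ∏ b ∈ K, (M.count b)! := by
      apply prod_subset
      · rw [hK, Multiset.toFinset_cons]
        exact subset_insert _ _
      · intro b _ hb
        rw [Multiset.mem_toFinset] at hb
        rw [Multiset.count_eq_zero_of_notMem hb, factorial_zero]
    have h2 : ∏ b ∈ K, ((a ::ₘ M).count b)! = (M.count a + 1) * ∏ b ∈ K, (M.count b)! := by
      rw [← mul_prod_erase K _ haK, ← mul_prod_erase K (fun b => (M.count b)!) haK,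
        Multiset.count_cons_self, factorial_succ, mul_assoc]
      congr 2
      refine prod_congr rfl fun b hb => ?_
      rw [Multiset.count_cons_of_ne (ne_of_mem_erase hb)]
    have h3 : a * M.count a ≤ M.sum := by
      have : Multiset.replicate (M.count a) a ≤ M :=
        Multiset.le_count_iff_replicate_le.mp le_rfl
      obtain ⟨N, hN⟩ := Multiset.le_iff_exists_add.mp this
      have h4 := congrArg Multiset.sum hN
      rw [Multiset.sum_add, Multiset.sum_replicate, smul_eq_mul] at h4
      rw [h4, mul_comm]
      exact Nat.le_add_right _ _
    rw [Multiset.prod_cons, h2, ← h1, Multiset.sum_cons]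
    calc a * M.prod * ((M.count a + 1) * ∏ b ∈ M.toFinset, (M.count b)!)
        = (a * (M.count a + 1)) * (M.prod * ∏ b ∈ M.toFinset, (M.count b)!) := by ring
      _ ≤ (a + M.sum) * M.sum‼ := by
          refine Nat.mul_le_mul ?_ ih
          rw [mul_add, mul_one, add_comm]
          exact Nat.add_le_add_left h3 a
      _ ≤ (a + M.sum) * (a + M.sum - 2)‼ :=
          Nat.mul_le_mul_left _ (doubleFactorial_mono (by omega))
      _ = (a + M.sum)‼ := by
          obtain ⟨k, hk⟩ : ∃ k, a + M.sum = k + 2 := ⟨a + M.sum - 2, by omega⟩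
          rw [hk, doubleFactorial_add_two, Nat.add_sub_cancel]

/-- The number of elements moved by a self-equivalence. -/
noncomputable def moved {X : Type*} [Fintype X] (α : X ≃ X) : ℕ :=
  ∑ x, if α x = x then 0 else 1

theorem moved_eq_card_support {X : Type*} [Fintype X] (α : Equiv.Perm X) :
    moved α = α.support.card := by
  rw [Equiv.Perm.support, card_filter, moved]
  exact sum_congr rfl fun x _ => by split_ifs <;> simp_all

/-- The number of bijections intertwining two permutations. -/
noncomputable def matchCount {X Y : Type*} [Fintype X] [Fintype Y] (α : X ≃ X) (β : Y ≃ Y) : ℕ :=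
  ((univ : Finset (X ≃ Y)).filter fun v => α.trans v = v.trans β).card

variable {X Y : Type*} [Fintype X] [Fintype Y]

theorem moved_eq_of_trans_eq {α : X ≃ X} {β : Y ≃ Y} {v : X ≃ Y}
    (h : α.trans v = v.trans β) : moved α = moved β := by
  rw [moved, moved, ← v.sum_comp]
  refine sum_congr rfl fun x _ => ?_
  have := Equiv.congr_fun h x
  simp only [Equiv.trans_apply] at this
  rw [← this]
  simp

theorem matchCount_eq_card_centralizer {α : Equiv.Perm X} {β : Y ≃ Y} {v : X ≃ Y}
    (h : α.trans v = v.trans β) :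
    matchCount α β = Nat.card (Subgroup.centralizer {α}) := by
  rw [matchCount, ← Fintype.card_subtype, ← Nat.card_eq_fintype_card]
  have h' : ∀ x, v (α x) = β (v x) := fun x => Equiv.congr_fun h x
  refine Nat.card_congr (Equiv.subtypeEquiv ((Equiv.refl X).equivCongr v.symm) fun w => ?_)
  rw [Subgroup.mem_centralizer_singleton_iff]
  constructor
  · intro hw
    have hw' : ∀ x, w (α x) = β (w x) := fun x => Equiv.congr_fun hw x
    ext x
    simp [hw']
    rw [Equiv.symm_apply_eq, h']
    simp
  · intro hw
    have hw' : ∀ x, v.symm (w (α x)) = α (v.symm (w x)) := fun x => by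
      simpa using Equiv.congr_fun hw x
    ext x
    have := hw' x
    rw [Equiv.symm_apply_eq, h'] at this
    simpa using this

theorem matchCount_le (α : X ≃ X) (β : Y ≃ Y) :
    matchCount α β ≤
      if moved α = moved β then (Fintype.card X - moved α)! * (moved α)‼ else 0 := by
  by_cases hv : ∃ v : X ≃ Y, α.trans v = v.trans β
  · obtain ⟨v, hv⟩ := hv
    rw [if_pos (moved_eq_of_trans_eq hv), matchCount_eq_card_centralizer hv,
      Equiv.Perm.nat_card_centralizer, Equiv.Perm.sum_cycleType, ← moved_eq_card_support,
      mul_assoc]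
    refine Nat.mul_le_mul_left _ ?_
    rw [moved_eq_card_support, ← Equiv.Perm.sum_cycleType]
    exact multiset_prod_mul_count_factorial_le _
      fun a ha => Equiv.Perm.two_le_of_mem_cycleType ha
  · rw [matchCount, Finset.card_eq_zero.mpr]
    · exact Nat.zero_le _
    · rw [filter_eq_empty_iff]
      exact fun v _ h => hv ⟨v, h⟩

theorem cycleType_of_involution {α : Equiv.Perm X} (hα : ∀ x, α (α x) = x) {s : ℕ}
    (hs : moved α = 2 * s) : α.cycleType = Multiset.replicate s 2 := by
  have : Fact (Nat.Prime 2) := ⟨Nat.prime_two⟩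
  have h := Equiv.Perm.cycleType_of_pow_prime_eq_one (σ := α) (p := 2)
    (by ext x; simp [pow_two, hα])
  have h2 : (Multiset.card α.cycleType) * 2 = 2 * s := by
    rw [← hs, moved_eq_card_support, ← Equiv.Perm.sum_cycleType]
    conv_rhs => rw [h]
    simp
  rw [h, show Multiset.card α.cycleType = s by omega]

theorem matchCount_of_involution (w : X ≃ Y) {α : Equiv.Perm X} {β : Equiv.Perm Y}
    (hα : ∀ x, α (α x) = x) (hβ : ∀ x, β (β x) = x) {s : ℕ} (hs : moved α = 2 * s)
    (hs' : moved β = 2 * s) :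
    matchCount α β = (Fintype.card X - 2 * s)! * (2 ^ s * s !) := by
  have hc := cycleType_of_involution hα hs
  have hγ : moved (w.trans (β.trans w.symm) : X ≃ X) = 2 * s := by
    rw [← hs']
    exact moved_eq_of_trans_eq (v := w) (by ext x; simp)
  have hc' := cycleType_of_involution (α := (w.trans (β.trans w.symm) : X ≃ X))
    (by simp [hβ]) hγ
  obtain ⟨c, hc''⟩ := isConj_iff.mp (Equiv.Perm.isConj_iff_cycleType_eq.mpr (hc.trans hc'.symm))
  have hv : α.trans ((c : X ≃ X).trans w) = ((c : X ≃ X).trans w).trans β := by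
    ext x
    have := Equiv.congr_fun hc'' (c x)
    have h2 : c⁻¹ (c x) = x := c.symm_apply_apply x
    simp only [Equiv.Perm.mul_apply, h2, Equiv.trans_apply] at this
    simp [this]
  rw [matchCount_eq_card_centralizer hv, Equiv.Perm.nat_card_centralizer, hc]
  rcases Nat.eq_zero_or_pos s with rfl | hs0
  · simp
  · rw [Multiset.toFinset_replicate, if_neg (by omega)]
    simp [mul_assoc, mul_comm s 2]

end Matchings

namespace PTree

open Finset Nat

theorem symCount_eq (T S : PTree) :
    symCount T S = ∑ e : Iso T T, ∑ e' : Iso S S, matchCount e.toEquiv e'.toEquiv := by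
  simp only [symCount, intertwiners, matchCount, card_filter]
  rw [sum_comm, Fintype.sum_prod_type]

/-- The number of automorphisms of `T` moving exactly `m` leaves. -/
noncomputable def autMoved (T : PTree) (m : ℕ) : ℕ :=
  ((univ : Finset (Iso T T)).filter fun e => moved e.toEquiv = m).card

/-- The number of automorphisms of `T` of order at most two moving exactly `2 * s` leaves. -/
noncomputable def invCount (T : PTree) (s : ℕ) : ℕ :=
  ((univ : Finset (Iso T T)).filter fun e =>
    (∀ x, e.toEquiv (e.toEquiv x) = x) ∧ moved e.toEquiv = 2 * s).card

theorem moved_le {T : PTree} (e : Iso T T) : moved e.toEquiv ≤ T.size := by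
  rw [← card_leaves, moved, Fintype.card_eq_sum_ones]
  exact sum_le_sum fun x _ => by split_ifs <;> simp

theorem symCount_le (T S : PTree) :
    symCount T S ≤ ∑ m ∈ range (T.size + 1),
      (T.size - m)! * m‼ * (autMoved T m * autMoved S m) := by
  rw [symCount_eq]
  have h : ∀ (e : Iso T T) (e' : Iso S S), matchCount e.toEquiv e'.toEquiv ≤
      ∑ m ∈ range (T.size + 1), (T.size - m)! * m‼ *
        ((if moved e.toEquiv = m then 1 else 0) * if moved e'.toEquiv = m then 1 else 0) := by
    intro e e'
    refine (matchCount_le _ _).trans ?_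
    rw [card_leaves]
    split_ifs with h
    · refine le_trans (le_of_eq ?_) (single_le_sum (fun _ _ => Nat.zero_le _)
        (mem_range.mpr (Nat.lt_succ_of_le (moved_le e))))
      simp [h]
    · exact Nat.zero_le _
  refine (sum_le_sum fun e _ => sum_le_sum fun e' _ => h e e').trans (le_of_eq ?_)
  simp only [autMoved, card_filter, sum_mul_sum]
  simp only [mul_sum]
  rw [sum_congr rfl fun e _ => sum_comm, sum_comm]

theorem le_symCount {T S : PTree} (hTS : T.size = S.size) (L : ℕ) :
    ∑ s ∈ range L, (T.size - 2 * s)! * (2 ^ s * s !) * (invCount T s * invCount S s) ≤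
      symCount T S := by
  rw [symCount_eq]
  have w : Leaves T ≃ Leaves S := (num T).trans ((finCongr hTS).trans (num S).symm)
  have h : ∀ (e : Iso T T) (e' : Iso S S),
      ∑ s ∈ range L, (T.size - 2 * s)! * (2 ^ s * s !) *
        ((if (∀ x, e.toEquiv (e.toEquiv x) = x) ∧ moved e.toEquiv = 2 * s then 1 else 0) *
        if (∀ x, e'.toEquiv (e'.toEquiv x) = x) ∧ moved e'.toEquiv = 2 * s then 1 else 0) ≤
      matchCount e.toEquiv e'.toEquiv := by
    intro e e'
    have h1 : ∀ s ∈ range L, (T.size - 2 * s)! * (2 ^ s * s !) *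
        ((if (∀ x, e.toEquiv (e.toEquiv x) = x) ∧ moved e.toEquiv = 2 * s then 1 else 0) *
        if (∀ x, e'.toEquiv (e'.toEquiv x) = x) ∧ moved e'.toEquiv = 2 * s then 1 else 0) ≤
        if s = moved e.toEquiv / 2 then matchCount e.toEquiv e'.toEquiv else 0 := by
      intro s _
      by_cases h2 : (∀ x, e.toEquiv (e.toEquiv x) = x) ∧ moved e.toEquiv = 2 * s
      · by_cases h3 : (∀ x, e'.toEquiv (e'.toEquiv x) = x) ∧ moved e'.toEquiv = 2 * s
        · rw [if_pos h2, if_pos h3, if_pos (by rw [h2.2]; omega),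
            matchCount_of_involution w h2.1 h3.1 h2.2 h3.2, card_leaves]
          simp
        · simp [h3]
      · simp [h2]
    refine (sum_le_sum h1).trans ?_
    rw [sum_ite_eq']
    split_ifs
    · exact le_rfl
    · exact Nat.zero_le _
  refine le_trans (le_of_eq ?_) (sum_le_sum fun e _ => sum_le_sum fun e' _ => h e e')
  simp only [invCount, card_filter, sum_mul_sum]
  simp only [mul_sum]
  rw [sum_comm, sum_congr rfl fun e _ => sum_comm]

theorem moved_sumCongr {X Y : Type*} [Fintype X] [Fintype Y] (α : X ≃ X) (β : Y ≃ Y) :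
    moved (Equiv.sumCongr α β) = moved α + moved β := by
  simp only [moved, Fintype.sum_sum_type, Equiv.sumCongr_apply, Sum.map_inl, Sum.map_inr,
    Sum.inl.injEq, Sum.inr.injEq]

theorem moved_inl {l r : PTree} (g : Iso l l) (h : Iso r r) :
    moved (Iso.toEquiv (T := node l r) (T' := node l r) (Sum.inl (g, h))) =
      moved g.toEquiv + moved h.toEquiv :=
  moved_sumCongr _ _

theorem moved_inr {l r : PTree} (g : Iso l r) (h : Iso r l) :
    moved (Iso.toEquiv (T := node l r) (T' := node l r) (Sum.inr (g, h))) =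
      l.size + r.size := by
  have : ∀ x, Iso.toEquiv (T := node l r) (T' := node l r) (Sum.inr (g, h)) x ≠ x := by
    rintro (x | x) hx <;> cases hx
  simp only [moved, this, if_false]
  rw [← Fintype.card_eq_sum_ones, card_leaves, size]

theorem invCount_node (l r : PTree) (s : ℕ) :
    ∑ p ∈ antidiagonal s, invCount l p.1 * invCount r p.2 ≤ invCount (node l r) s := by
  simp only [invCount, ← card_product]
  rw [← card_sigma]
  refine card_le_card_of_injOn (fun x => Sum.inl (x.2.1, x.2.2)) ?_ ?_
  · rintro ⟨⟨i, j⟩, g, h⟩ hx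
    simp only [coe_sigma, Set.mem_sigma_iff, mem_coe, HasAntidiagonal.mem_antidiagonal,
      mem_product, mem_filter, mem_univ, true_and] at hx
    refine mem_coe.mpr (mem_filter.mpr ⟨mem_univ _, ?_, ?_⟩)
    · rintro (x | x)
      · exact congrArg Sum.inl (hx.2.1.1 x)
      · exact congrArg Sum.inr (hx.2.2.1 x)
    · rw [moved_inl, hx.2.1.2, hx.2.2.2, ← hx.1, mul_add]
  · rintro ⟨⟨i, j⟩, g, h⟩ hx ⟨⟨i', j'⟩, g', h'⟩ hx' heq
    simp only [coe_sigma, Set.mem_sigma_iff, mem_coe, HasAntidiagonal.mem_antidiagonal,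
      mem_product, mem_filter, mem_univ, true_and] at hx hx'
    obtain ⟨rfl, rfl⟩ : g = g' ∧ h = h' := Prod.mk.inj (Sum.inl_injective heq)
    obtain rfl : i = i' := by
      have := hx.2.1.2
      have := hx'.2.1.2
      omega
    obtain rfl : j = j' := by
      have := hx.2.2.2
      have := hx'.2.2.2
      omega
    rfl

theorem one_le_invCount_zero (T : PTree) : 1 ≤ invCount T 0 := by
  obtain ⟨e, he⟩ := Iso.exists_refl T
  rw [invCount, Nat.one_le_iff_ne_zero, Finset.card_ne_zero]
  exact ⟨e, by simp [he, moved]⟩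

theorem cherries_node {l r : PTree} (h : ¬(l = leaf ∧ r = leaf)) :
    cherries (node l r) = cherries l + cherries r := by
  cases l <;> cases r <;> simp_all [cherries]

theorem choose_cherries_le : ∀ (T : PTree) (s : ℕ), (cherries T).choose s ≤ invCount T s
  | leaf, 0 => one_le_invCount_zero _
  | leaf, s + 1 => by simp [cherries]
  | node l r, s => by
    by_cases h : l = leaf ∧ r = leaf
    · obtain ⟨rfl, rfl⟩ := h
      rw [show cherries (node leaf leaf) = 1 from rfl]
      match s with
      | 0 => exact one_le_invCount_zero _
      | 1 =>
        rw [Nat.choose_self, invCount, Nat.one_le_iff_ne_zero, Finset.card_ne_zero]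
        refine ⟨Sum.inr ((), ()), mem_filter.mpr ⟨mem_univ _, ?_, moved_inr _ _⟩⟩
        rintro (x | x) <;> rfl
      | s + 2 => simp [Nat.choose]
    · rw [cherries_node h, Nat.add_choose_eq]
      refine le_trans (sum_le_sum fun p _ => ?_) (invCount_node l r s)
      exact Nat.mul_le_mul (choose_cherries_le l p.1) (choose_cherries_le r p.2)

end PTree

section TreeSeries

open Finset Polynomial

theorem eq_of_quadratic_rec {R : Type*} [CommSemiring R] {a a' c : ℕ → R}
    (h0 : a 0 = 0) (h0' : a' 0 = 0)
    (h : ∀ n, a n = c n + ∑ p ∈ antidiagonal n, a p.1 * a p.2)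
    (h' : ∀ n, a' n = c n + ∑ p ∈ antidiagonal n, a' p.1 * a' p.2) (n : ℕ) : a n = a' n := by
  induction n using Nat.strong_induction_on with
  | _ n ih =>
    rw [h, h']
    congr 1
    refine sum_congr rfl fun p hp => ?_
    rw [HasAntidiagonal.mem_antidiagonal] at hp
    rcases Nat.eq_zero_or_pos p.1 with h1 | h1
    · rw [h1, h0, h0', zero_mul, zero_mul]
    rcases Nat.eq_zero_or_pos p.2 with h2 | h2
    · rw [h2, h0, h0', mul_zero, mul_zero]
    rw [ih p.1 (by omega), ih p.2 (by omega)]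

theorem coeff_pow_eq_zero {R : Type*} [CommSemiring R] {y : PowerSeries R}
    (hy : PowerSeries.coeff 0 y = 0) {n N : ℕ} (h : n < N) : PowerSeries.coeff n (y ^ N) = 0 := by
  apply PowerSeries.coeff_of_lt_order
  refine lt_of_lt_of_le ?_ (PowerSeries.le_order_pow_of_constantCoeff_eq_zero N (by simpa using hy))
  exact_mod_cast h

open PTree in
theorem quadratic_rec_solution {R : Type*} [CommSemiring R] {a : ℕ → R} {y : PowerSeries R}
    (hy : PowerSeries.coeff 0 y = 0) (h0 : a 0 = 0)
    (h : ∀ n, a n = PowerSeries.coeff n y + ∑ p ∈ antidiagonal n, a p.1 * a p.2) (n : ℕ) :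
    a n = ∑ N ∈ range (n + 1), (numTrees N : R) * PowerSeries.coeff n (y ^ N) := by
  refine eq_of_quadratic_rec (a' := fun n => ∑ N ∈ range (n + 1),
    (numTrees N : R) * PowerSeries.coeff n (y ^ N)) h0 ?_ h (fun n => ?_) n
  · simp [numTrees_zero]
  have hext : ∀ i L, i ≤ L → ∑ N ∈ range (i + 1), (numTrees N : R) * PowerSeries.coeff i (y ^ N) =
      ∑ N ∈ range (L + 1), (numTrees N : R) * PowerSeries.coeff i (y ^ N) := by
    intro i L hL
    refine sum_subset (range_subset_range.mpr (by omega)) fun N _ hN => ?_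
    rw [coeff_pow_eq_zero hy (by simpa using hN), mul_zero]
  have h1 : ∑ p ∈ antidiagonal n,
      (∑ N ∈ range (p.1 + 1), (numTrees N : R) * PowerSeries.coeff p.1 (y ^ N)) *
        (∑ N ∈ range (p.2 + 1), (numTrees N : R) * PowerSeries.coeff p.2 (y ^ N)) =
      ∑ N ∈ range (n + 1), ∑ M ∈ range (n + 1),
        (numTrees N : R) * numTrees M * PowerSeries.coeff n (y ^ (N + M)) := by
    have : ∀ p ∈ antidiagonal n,
      (∑ N ∈ range (p.1 + 1), (numTrees N : R) * PowerSeries.coeff p.1 (y ^ N)) *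
        (∑ N ∈ range (p.2 + 1), (numTrees N : R) * PowerSeries.coeff p.2 (y ^ N)) =
      ∑ N ∈ range (n + 1), ∑ M ∈ range (n + 1), (numTrees N : R) * numTrees M *
        (PowerSeries.coeff p.1 (y ^ N) * PowerSeries.coeff p.2 (y ^ M)) := by
      intro p hp
      rw [HasAntidiagonal.mem_antidiagonal] at hp
      rw [hext p.1 n (by omega), hext p.2 n (by omega), sum_mul_sum]
      exact sum_congr rfl fun _ _ => sum_congr rfl fun _ _ => by ring
    rw [sum_congr rfl this, sum_comm]
    refine sum_congr rfl fun N _ => ?_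
    rw [sum_comm]
    refine sum_congr rfl fun M _ => ?_
    rw [pow_add, PowerSeries.coeff_mul, mul_sum]
  rw [h1, ← sum_product']
  have h2 : ∑ x ∈ range (n + 1) ×ˢ range (n + 1),
      (numTrees x.1 : R) * numTrees x.2 * PowerSeries.coeff n (y ^ (x.1 + x.2)) =
      ∑ K ∈ range (n + 1), ∑ p ∈ antidiagonal K,
        (numTrees p.1 : R) * numTrees p.2 * PowerSeries.coeff n (y ^ (p.1 + p.2)) := by
    rw [sum_sigma']
    refine sum_bij_ne_zero (fun x _ _ => ⟨x.1 + x.2, x⟩) ?_ ?_ ?_ ?_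
    · intro x _ hx
      have : ¬ n < x.1 + x.2 := fun hlt => hx (by rw [coeff_pow_eq_zero hy hlt, mul_zero])
      simp only [mem_sigma, mem_range, HasAntidiagonal.mem_antidiagonal, and_true]
      omega
    · rintro x _ _ x' _ _ hxx
      simp only [Sigma.mk.injEq, heq_eq_eq] at hxx
      exact hxx.2
    · rintro ⟨K, p⟩ hp hne
      simp only [mem_sigma, mem_range, HasAntidiagonal.mem_antidiagonal] at hp
      obtain ⟨hp, rfl⟩ := hp
      refine ⟨p, ?_, hne, rfl⟩
      simp only [mem_product, mem_range]
      omega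
    · intros; rfl
  rw [h2]
  have h3 : ∀ K, (numTrees K : R) = (if K = 1 then 1 else 0) +
      ∑ p ∈ antidiagonal K, (numTrees p.1 : R) * numTrees p.2 := by
    intro K
    rw [numTrees_rec]
    push_cast
    rfl
  have h4 : PowerSeries.coeff n y = ∑ K ∈ range (n + 1),
      (if K = 1 then (1 : R) else 0) * PowerSeries.coeff n (y ^ K) := by
    simp only [ite_mul, one_mul, zero_mul]
    rw [sum_ite_eq']
    split_ifs with h
    · rw [pow_one]
    · obtain rfl : n = 0 := by simpa using h
      exact hy
  rw [h4, ← sum_add_distrib]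
  refine sum_congr rfl fun K _ => ?_
  rw [h3 K, add_mul, sum_mul]
  congr 1
  refine sum_congr rfl fun p hp => ?_
  rw [HasAntidiagonal.mem_antidiagonal.mp hp]

open PTree in
theorem coeff_of_rec {f : ℕ → ℕ[X]} {b : ℕ → ℕ} (hb : b 0 = 0) (hf0 : f 0 = 0)
    (hf : ∀ n, f n = (if n = 1 then 1 else 0) + (b n : ℕ[X]) * X ^ n +
      ∑ p ∈ antidiagonal n, f p.1 * f p.2) {m n : ℕ} (hmn : m ≤ n) :
    (f n).coeff m = ∑ k ∈ range (m + 1), numTrees (n - m + k) *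
      ((n - m + k).choose k * PowerSeries.coeff m ((PowerSeries.mk b) ^ k)) := by
  set B : PowerSeries ℕ[X] :=
    PowerSeries.rescale X (PowerSeries.map C (PowerSeries.mk b)) with hB
  have hcB : ∀ k j, PowerSeries.coeff j (B ^ k) =
      X ^ j * C (PowerSeries.coeff j ((PowerSeries.mk b) ^ k)) := by
    intro k j
    rw [hB, ← map_pow, ← map_pow, PowerSeries.coeff_rescale, PowerSeries.coeff_map]
  have hcB1 : ∀ n, PowerSeries.coeff n B = (b n : ℕ[X]) * X ^ n := by
    intro n
    have := hcB 1 n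
    rw [pow_one, pow_one, PowerSeries.coeff_mk] at this
    rw [this, mul_comm]
    simp
  have hy0 : PowerSeries.coeff 0 (PowerSeries.X + B) = 0 := by
    rw [map_add, hcB1, hb]
    simp
  rw [quadratic_rec_solution hy0 hf0 (fun n => by
    rw [map_add, hcB1, PowerSeries.coeff_X]; exact hf n) n]
  have h1 : ∀ N ∈ range (n + 1),
      ((numTrees N : ℕ[X]) * PowerSeries.coeff n ((PowerSeries.X + B) ^ N)).coeff m =
      ∑ k ∈ range (N + 1), if N - k = n - m then numTrees N *
        (N.choose k * PowerSeries.coeff m ((PowerSeries.mk b) ^ k)) else 0 := by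
    intro N hN
    rw [add_comm, add_pow, map_sum, ← C_eq_natCast, coeff_C_mul, finsetSum_coeff, mul_sum]
    refine sum_congr rfl fun k hk => ?_
    rw [mem_range] at hN hk
    rw [mul_right_comm, mul_comm _ (PowerSeries.X ^ _), PowerSeries.coeff_X_pow_mul', if_pos (by omega),
      ← nsmul_eq_mul', map_nsmul, hcB, coeff_smul, mul_comm (X ^ _), coeff_C_mul_X_pow, smul_ite, mul_ite]
    by_cases h : N - k = n - m
    · have h' : m = n - (N - k) := by omega
      rw [if_pos h, if_pos h', ← h']
      simp
    · have h' : m ≠ n - (N - k) := by omega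
      rw [if_neg h, if_neg h']
      simp
  rw [finsetSum_coeff, sum_congr rfl h1, sum_sigma', ← sum_filter]
  refine sum_nbij' (fun x => x.2) (fun k => ⟨n - m + k, k⟩) ?_ ?_ ?_ ?_ ?_
  · rintro ⟨N, k⟩ h
    simp only [mem_filter, mem_sigma, mem_range] at h ⊢
    omega
  · intro k h
    simp only [mem_filter, mem_sigma, mem_range] at h ⊢
    omega
  · rintro ⟨N, k⟩ h
    simp only [mem_filter, mem_sigma, mem_range] at h
    obtain rfl : N = n - m + k := by omega
    rfl
  · intro k _
    rfl
  · rintro ⟨N, k⟩ h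
    simp only [mem_filter, mem_sigma, mem_range] at h
    obtain rfl : N = n - m + k := by omega
    rfl

end TreeSeries

section PowCoeff

open Finset

/-- The coefficients of the powers of the generating function of a sequence. -/
noncomputable def powCoeff (b : ℕ → ℕ) (m k : ℕ) : ℕ := PowerSeries.coeff m (PowerSeries.mk b ^ k)

theorem powCoeff_zero (b : ℕ → ℕ) (m : ℕ) : powCoeff b m 0 = if m = 0 then 1 else 0 := by
  rw [powCoeff, pow_zero, PowerSeries.coeff_one]

theorem powCoeff_succ (b : ℕ → ℕ) (m k : ℕ) :
    powCoeff b m (k + 1) = ∑ p ∈ antidiagonal m, powCoeff b p.1 k * b p.2 := by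
  simp [powCoeff, pow_succ, PowerSeries.coeff_mul]

variable {b : ℕ → ℕ}

theorem powCoeff_odd (hodd : ∀ n, Odd n → b n = 0) {m : ℕ} (hm : Odd m) (k : ℕ) :
    powCoeff b m k = 0 := by
  induction k generalizing m with
  | zero =>
    rw [powCoeff_zero, if_neg]
    rintro rfl
    simp at hm
  | succ k ih =>
    rw [powCoeff_succ]
    refine sum_eq_zero fun p hp => ?_
    rw [HasAntidiagonal.mem_antidiagonal] at hp
    rcases Nat.even_or_odd p.1 with h | h
    · rw [hodd p.2, mul_zero]
      rw [← hp, Nat.odd_add] at hm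
      by_contra h'
      rw [Nat.not_odd_iff_even] at h'
      exact (Nat.not_odd_iff_even.mpr h) (hm.mpr h')
    · rw [ih h, zero_mul]

theorem powCoeff_of_lt (h0 : b 0 = 0) (h1 : b 1 = 0) {m k : ℕ} (hm : m < 2 * k) :
    powCoeff b m k = 0 := by
  induction k generalizing m with
  | zero => omega
  | succ k ih =>
    rw [powCoeff_succ]
    refine sum_eq_zero fun p hp => ?_
    rw [HasAntidiagonal.mem_antidiagonal] at hp
    rcases Nat.lt_or_ge p.2 2 with h | h
    · have : b p.2 = 0 := by interval_cases p.2 <;> assumption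
      rw [this, mul_zero]
    · rw [ih (by omega), zero_mul]

theorem powCoeff_two_mul (h0 : b 0 = 0) (h1 : b 1 = 0) (h2 : b 2 = 1) (k : ℕ) :
    powCoeff b (2 * k) k = 1 := by
  induction k with
  | zero => rw [powCoeff_zero]; rfl
  | succ k ih =>
    rw [powCoeff_succ, sum_eq_single (2 * k, 2)]
    · simp [ih, h2]
    · intro p hp hne
      rw [HasAntidiagonal.mem_antidiagonal] at hp
      rcases Nat.lt_or_ge p.2 2 with h | h
      · have : b p.2 = 0 := by interval_cases p.2 <;> assumption
        rw [this, mul_zero]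
      · rw [powCoeff_of_lt h0 h1, zero_mul]
        by_contra h'
        exact hne (Prod.ext (by simp only; omega) (by simp only; omega))
    · intro h
      exact absurd (HasAntidiagonal.mem_antidiagonal.mpr (by ring)) h

theorem powCoeff_le (h0 : b 0 = 0) (hb : ∀ n, b n ≤ 4 ^ n) (m k : ℕ) :
    powCoeff b m k ≤ 8 ^ m := by
  induction k generalizing m with
  | zero =>
    rw [powCoeff_zero]
    split_ifs
    · exact Nat.one_le_pow _ _ (by norm_num)
    · exact Nat.zero_le _
  | succ k ih =>
    have hgeom : ∀ m : ℕ, ∑ p ∈ antidiagonal m, 8 ^ p.1 * 4 ^ p.2 + 4 ^ m = 2 * 8 ^ m := by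
      intro m
      induction m with
      | zero => rfl
      | succ m ih =>
        rw [Nat.sum_antidiagonal_succ]
        simp only [pow_succ, pow_zero, one_mul]
        have : ∑ p ∈ antidiagonal m, 8 ^ p.1 * 8 * 4 ^ p.2 =
            8 * ∑ p ∈ antidiagonal m, 8 ^ p.1 * 4 ^ p.2 := by
          rw [mul_sum]
          exact sum_congr rfl fun _ _ => by ring
        rw [this]
        omega
    have h1 : powCoeff b m (k + 1) + 8 ^ m ≤ ∑ p ∈ antidiagonal m, 8 ^ p.1 * 4 ^ p.2 := by
      have hm : (m, 0) ∈ antidiagonal m := HasAntidiagonal.mem_antidiagonal.mpr (by simp)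
      rw [powCoeff_succ, ← add_sum_erase _ _ hm, ← add_sum_erase _ (fun p => 8 ^ p.1 * 4 ^ p.2) hm]
      simp only [h0, mul_zero, zero_add, pow_zero, mul_one]
      rw [add_comm]
      exact Nat.add_le_add_left (sum_le_sum fun p _ => Nat.mul_le_mul (ih _) (hb _)) _
    have h2 := hgeom m
    have h3 : 0 ≤ 4 ^ m := Nat.zero_le _
    linarith

end PowCoeff

namespace PTree

open Finset Polynomial

theorem card_iso_eq_zero {T S : PTree} (h : T.size ≠ S.size) : Fintype.card (Iso T S) = 0 :=
  Fintype.card_eq_zero_iff.mpr ⟨fun e => h e.size_eq⟩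

theorem card_iso_le (T S : PTree) : Fintype.card (Iso T S) ≤ 2 ^ (T.size - 1) := by
  by_cases h : T.size = S.size
  · have h1 := sum_card_iso T T.size
    rw [if_pos rfl] at h1
    rw [← h1]
    exact single_le_sum (f := fun S => Fintype.card (Iso T S)) (fun _ _ => Nat.zero_le _)
      (mem_planeTrees.mpr h.symm)
  · rw [card_iso_eq_zero h]
    exact Nat.zero_le _

/-- The number of swapping automorphisms of the plane trees of size `n`. -/
noncomputable def swapCount (n : ℕ) : ℕ :=
  ∑ p ∈ antidiagonal n, ∑ l ∈ planeTrees p.1, ∑ r ∈ planeTrees p.2,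
    Fintype.card (Iso l r) * Fintype.card (Iso r l)

theorem swapCount_zero : swapCount 0 = 0 := by simp [swapCount, planeTrees]

theorem swapCount_odd (n : ℕ) (hn : Odd n) : swapCount n = 0 := by
  refine sum_eq_zero fun p hp => sum_eq_zero fun l hl => sum_eq_zero fun r hr => ?_
  rw [HasAntidiagonal.mem_antidiagonal] at hp
  rw [mem_planeTrees] at hl hr
  rw [card_iso_eq_zero, zero_mul]
  rintro h
  rw [← hp, ← hl, ← hr, h, Nat.odd_iff] at hn
  omega

theorem swapCount_two : swapCount 2 = 1 := by
  rw [swapCount, sum_eq_single (1, 1)]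
  · simp only [planeTrees, sum_singleton]
    have : Fintype.card (Iso leaf leaf) = 1 := Fintype.card_unit
    rw [this]
  · intro p hp hne
    rw [HasAntidiagonal.mem_antidiagonal] at hp
    refine sum_eq_zero fun l hl => sum_eq_zero fun r hr => ?_
    rw [mem_planeTrees] at hl hr
    have := l.size_pos
    have := r.size_pos
    exact absurd (Prod.ext (by simp only; omega) (by simp only; omega)) hne
  · intro h
    exact absurd (HasAntidiagonal.mem_antidiagonal.mpr (by norm_num)) h

theorem swapCount_le (n : ℕ) : swapCount n ≤ 4 ^ n := by
  by_cases hn : ∃ p, n = p + p ∧ 0 < p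
  · obtain ⟨p, rfl, hp⟩ := hn
    rw [swapCount, sum_eq_single (p, p)]
    · calc ∑ l ∈ planeTrees p, ∑ r ∈ planeTrees p,
            Fintype.card (Iso l r) * Fintype.card (Iso r l)
          ≤ ∑ l ∈ planeTrees p, 2 ^ (p - 1) * 2 ^ (p - 1) := by
            refine sum_le_sum fun l hl => ?_
            rw [mem_planeTrees] at hl
            have h1 := sum_card_iso l p
            rw [hl, if_pos rfl] at h1
            rw [← h1, sum_mul, h1]
            refine sum_le_sum fun r hr => Nat.mul_le_mul_left _ ?_
            rw [mem_planeTrees] at hr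
            rw [← hr]
            exact card_iso_le _ _
        _ = numTrees p * 4 ^ (p - 1) := by
            rw [sum_const, smul_eq_mul, ← mul_pow, numTrees]
            norm_num
        _ ≤ 4 ^ p * 4 ^ p := by
            refine Nat.mul_le_mul ?_ (Nat.pow_le_pow_right (by norm_num) (by omega))
            have := numTrees_le_pow (p - 1)
            rw [Nat.sub_add_cancel hp] at this
            exact this.trans (Nat.pow_le_pow_right (by norm_num) (by omega))
        _ = 4 ^ (p + p) := (pow_add _ _ _).symm
    · intro q hq hne
      rw [HasAntidiagonal.mem_antidiagonal] at hq
      refine sum_eq_zero fun l hl => sum_eq_zero fun r hr => ?_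
      rw [mem_planeTrees] at hl hr
      rw [card_iso_eq_zero, zero_mul]
      intro h
      exact hne (Prod.ext (by simp only; omega) (by simp only; omega))
    · intro h
      exact absurd (HasAntidiagonal.mem_antidiagonal.mpr (by norm_num)) h
  · refine le_of_eq_of_le ?_ (Nat.zero_le _)
    refine sum_eq_zero fun p hp => sum_eq_zero fun l hl => sum_eq_zero fun r hr => ?_
    rw [HasAntidiagonal.mem_antidiagonal] at hp
    rw [mem_planeTrees] at hl hr
    rw [card_iso_eq_zero, zero_mul]
    intro h
    exact hn ⟨p.1, by omega, by have := l.size_pos; omega⟩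

theorem rec_of_node {F : PTree → ℕ[X]} {g : PTree → PTree → ℕ} (hleaf : F leaf = 1)
    (hnode : ∀ l r, F (node l r) = F l * F r + (g l r : ℕ[X]) * X ^ (l.size + r.size)) (n : ℕ) :
    ∑ T ∈ planeTrees n, F T = (if n = 1 then 1 else 0) +
      ((∑ p ∈ antidiagonal n, ∑ l ∈ planeTrees p.1, ∑ r ∈ planeTrees p.2, g l r : ℕ) : ℕ[X]) *
        X ^ n +
      ∑ p ∈ antidiagonal n, (∑ T ∈ planeTrees p.1, F T) * ∑ T ∈ planeTrees p.2, F T := by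
  rw [sum_planeTrees, hleaf, add_assoc]
  congr 1
  push_cast
  rw [sum_mul, ← sum_add_distrib]
  refine sum_congr rfl fun p hp => ?_
  rw [HasAntidiagonal.mem_antidiagonal] at hp
  rw [sum_mul, sum_mul_sum, ← sum_add_distrib]
  refine sum_congr rfl fun l hl => ?_
  rw [sum_mul, ← sum_add_distrib]
  refine sum_congr rfl fun r hr => ?_
  rw [mem_planeTrees] at hl hr
  rw [hnode, hl, hr, hp, add_comm]

theorem sum_autMoved {m n : ℕ} (hmn : m ≤ n) :
    ∑ T ∈ planeTrees n, autMoved T m = ∑ k ∈ range (m + 1),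
      numTrees (n - m + k) * ((n - m + k).choose k * powCoeff swapCount m k) := by
  have hrec := rec_of_node (F := fun T => ∑ e : Iso T T, X ^ moved e.toEquiv)
    (g := fun l r => Fintype.card (Iso l r) * Fintype.card (Iso r l)) ?_ ?_
  · have := coeff_of_rec (f := fun n => ∑ T ∈ planeTrees n, ∑ e : Iso T T, X ^ moved e.toEquiv)
      swapCount_zero (by simp [planeTrees]) hrec hmn
    rw [finsetSum_coeff] at this
    refine Eq.trans (sum_congr rfl fun T _ => ?_) this
    simp only [finsetSum_coeff, coeff_X_pow, autMoved, card_filter]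
    exact sum_congr rfl fun e _ => by simp [eq_comm]
  · have : ∀ e : Iso leaf leaf, moved e.toEquiv = 0 := by
      intro e
      exact sum_eq_zero fun x _ => if_pos rfl
    simp only [this, pow_zero]
    rw [sum_const, card_univ, show Fintype.card (Iso leaf leaf) = 1 from Fintype.card_unit, one_smul]
  · intro l r
    refine (Fintype.sum_sum_type
      (fun e : (Iso l l × Iso r r) ⊕ (Iso l r × Iso r l) => (X : ℕ[X]) ^
        moved (Iso.toEquiv (T := node l r) (T' := node l r) e))).trans ?_
    congr 1
    · rw [sum_mul_sum, Fintype.sum_prod_type]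
      refine sum_congr rfl fun g _ => sum_congr rfl fun h _ => ?_
      rw [moved_inl, pow_add]
    · rw [sum_congr rfl fun p _ => by rw [moved_inr p.1 p.2]]
      rw [sum_const, card_univ, Fintype.card_prod, nsmul_eq_mul]

theorem sum_choose_cherries {s n : ℕ} (hs : 2 * s ≤ n) :
    ∑ T ∈ planeTrees n, (cherries T).choose s = numTrees (n - s) * (n - s).choose s := by
  have hrec := rec_of_node (F := fun T => (1 + X ^ 2) ^ cherries T)
    (g := fun l r => if l = leaf ∧ r = leaf then 1 else 0) ?_ ?_
  · set b : ℕ → ℕ := fun n => ∑ p ∈ antidiagonal n, ∑ l ∈ planeTrees p.1, ∑ r ∈ planeTrees p.2,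
      if l = leaf ∧ r = leaf then 1 else 0 with hb
    have hbX : PowerSeries.mk b = PowerSeries.X ^ 2 := by
      ext n
      rw [PowerSeries.coeff_mk, PowerSeries.coeff_X_pow]
      have : ∀ p : ℕ × ℕ, (∑ l ∈ planeTrees p.1, ∑ r ∈ planeTrees p.2,
          if l = leaf ∧ r = leaf then 1 else 0) = if p = (1, 1) then 1 else 0 := by
        intro p
        have : ∀ l r, (if l = leaf ∧ r = leaf then 1 else 0) =
            (if l = leaf then 1 else 0) * (if r = leaf then 1 else 0) := by
          intro l r
          split_ifs <;> simp_all
        simp only [this, ← sum_mul_sum, sum_ite_eq', mem_planeTrees, Prod.ext_iff]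
        simp only [size, eq_comm (a := 1)]
        split_ifs <;> simp_all
      simp only [hb, this]
      rw [sum_ite_eq']
      simp only [HasAntidiagonal.mem_antidiagonal, eq_comm]
    have h0 : b 0 = 0 := by
      have := congrArg (PowerSeries.coeff 0) hbX
      simpa using this
    have := coeff_of_rec (f := fun n => ∑ T ∈ planeTrees n, (1 + X ^ 2) ^ cherries T)
      h0 (by simp [planeTrees]) hrec hs
    rw [finsetSum_coeff] at this
    have hL : ∀ c : ℕ, ((1 + X ^ 2 : ℕ[X]) ^ c).coeff (2 * s) = c.choose s := by
      intro c
      rw [add_comm, add_pow, finsetSum_coeff]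
      have : ∀ k ∈ range (c + 1),
          ((X ^ 2) ^ k * 1 ^ (c - k) * (c.choose k : ℕ[X]) : ℕ[X]).coeff (2 * s) =
            if s = k then c.choose k else 0 := by
        intro k _
        rw [one_pow, mul_one, ← pow_mul, mul_comm, ← C_eq_natCast, coeff_C_mul_X_pow]
        simp
      rw [sum_congr rfl this, sum_ite_eq]
      split_ifs with h
      · rfl
      · rw [Nat.choose_eq_zero_of_lt (by simpa using h)]
    rw [sum_congr rfl fun T _ => (hL (cherries T)).symm, this, hbX, sum_eq_single s]
    · rw [← pow_mul, PowerSeries.coeff_X_pow_self, mul_one, show n - 2 * s + s = n - s by omega]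
    · intro k _ hk
      rw [← pow_mul, PowerSeries.coeff_X_pow, if_neg (by omega), mul_zero, mul_zero]
    · intro h
      simp at h
      omega
  · simp [cherries]
  · intro l r
    by_cases h : l = leaf ∧ r = leaf
    · obtain ⟨rfl, rfl⟩ := h
      simp [cherries, size]
    · simp only [cherries_node h, pow_add, if_neg h, Nat.cast_zero, zero_mul, add_zero]

end PTree

namespace PTree

open Finset Nat

/-- The main term in the number of automorphisms moving `2 * s` leaves. -/
noncomputable def mainTerm (n s : ℕ) : ℝ := numTrees (n - s) * (n - s).choose s

/-- The limiting value of the expected number of symmetries, truncated. -/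
noncomputable def truncExp (n : ℕ) : ℝ := ∑ s ∈ range (n / 2 + 1), (1 / 8 : ℝ) ^ s / s !

/-- The number of matchings preserved by two involutions moving `2 * s` leaves, divided by
`n !`. -/
noncomputable def weight (n s : ℕ) : ℝ := (n - 2 * s)! * (2 ^ s * s !) / n !

theorem mainTerm_succ (j s : ℕ) :
    mainTerm (2 * (s + 1) + j) (s + 1) * (2 * (2 * (j + s) + 1) * (s + 1)) =
      mainTerm (2 * (s + 1) + j) s * ((j + 2) * (j + 1)) := by
  have e1 : 2 * (s + 1) + j - (s + 1) = j + s + 1 := by omega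
  have e2 : 2 * (s + 1) + j - s = j + s + 2 := by omega
  rw [mainTerm, mainTerm, e1, e2]
  have h1 := numTrees_succ_mul (j + s + 1) (by omega)
  have h1' : ((j : ℝ) + s + 2) * numTrees (j + s + 2) = 2 * (2 * (j + s) + 1) *
      numTrees (j + s + 1) := by
    have e : 2 * (j + s + 1) - 1 = 2 * (j + s) + 1 := by omega
    rw [e] at h1
    have := congrArg (Nat.cast : ℕ → ℝ) h1
    push_cast at this
    linarith
  have h2 := Nat.choose_succ_right_eq (j + s + 2) s
  have h3 := Nat.choose_mul_succ_eq (j + s + 1) (s + 1)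
  rw [show j + s + 2 - s = j + 2 by omega] at h2
  rw [show j + s + 1 + 1 - (s + 1) = j + 1 by omega] at h3
  have h2' := congrArg (Nat.cast : ℕ → ℝ) h2
  have h3' := congrArg (Nat.cast : ℕ → ℝ) h3
  push_cast at h2' h3'
  have hne : (j : ℝ) + s + 2 ≠ 0 := by positivity
  apply mul_left_cancel₀ hne
  rw [show j + s + 1 + 1 = j + s + 2 from rfl] at h3'
  calc ((j : ℝ) + s + 2) * (numTrees (j + s + 1) * (j + s + 1).choose (s + 1) *
        (2 * (2 * (j + s) + 1) * (s + 1)))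
      = (2 * (2 * (j + s) + 1) * numTrees (j + s + 1)) *
        ((j + s + 1).choose (s + 1) * (j + s + 1 + 1)) * (s + 1) := by ring
    _ = (((j : ℝ) + s + 2) * numTrees (j + s + 2)) *
        ((j + s + 2).choose (s + 1) * (s + 1)) * (j + 1) := by rw [h1', h3']; ring
    _ = _ := by rw [h2']; ring

theorem weight_succ (j s : ℕ) :
    weight (2 * (s + 1) + j) (s + 1) * ((j + 2) * (j + 1)) =
      weight (2 * (s + 1) + j) s * (2 * (s + 1)) := by
  rw [weight, weight, show 2 * (s + 1) + j - 2 * (s + 1) = j by omega,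
    show 2 * (s + 1) + j - 2 * s = j + 2 by omega, factorial_succ (j + 1), factorial_succ j,
    factorial_succ s]
  push_cast
  ring

theorem weight_nonneg (n s : ℕ) : 0 ≤ weight n s := by
  unfold weight
  positivity

theorem weight_mul_mainTerm_succ (j s : ℕ) :
    weight (2 * (s + 1) + j) (s + 1) * mainTerm (2 * (s + 1) + j) (s + 1) ^ 2 =
      weight (2 * (s + 1) + j) s * mainTerm (2 * (s + 1) + j) s ^ 2 *
        (1 / 8 / (s + 1) * (((j + 2) * (j + 1)) / (j + s + 1 / 2) ^ 2)) := by
  have h1 := mainTerm_succ j s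
  have h2 := weight_succ j s
  have e1 : mainTerm (2 * (s + 1) + j) (s + 1) =
      mainTerm (2 * (s + 1) + j) s * ((j + 2) * (j + 1)) / (2 * (2 * (j + s) + 1) * (s + 1)) := by
    rw [eq_div_iff (by positivity), h1]
  have e2 : weight (2 * (s + 1) + j) (s + 1) =
      weight (2 * (s + 1) + j) s * (2 * (s + 1)) / ((j + 2) * (j + 1)) := by
    rw [eq_div_iff (by positivity), h2]
  rw [e1, e2]
  have : (2 * ((j : ℝ) + s) + 1) = 2 * (j + s + 1 / 2) := by ring
  rw [this]
  field_simp
  ring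

theorem weight_mul_mainTerm_le {n : ℕ} (hn : 3 ≤ n) (s : ℕ) (hs : 2 * s ≤ n) :
    weight n s * mainTerm n s ^ 2 ≤ (1 / 8 : ℝ) ^ s / s ! * (1 + 8 / n) * numTrees n ^ 2 := by
  induction s with
  | zero =>
    have : weight n 0 = 1 := by
      simp [weight, div_self (Nat.cast_ne_zero.mpr (Nat.factorial_ne_zero n) : (n ! : ℝ) ≠ 0)]
    rw [this]
    simp only [mainTerm, Nat.sub_zero, choose_zero_right, Nat.cast_one, mul_one, one_mul, pow_zero,
      factorial_zero, div_one]
    refine le_mul_of_one_le_left (by positivity) ?_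
    have : (0 : ℝ) ≤ 8 / n := by positivity
    linarith
  | succ s ih =>
    have ih := ih (by omega)
    obtain ⟨j, rfl⟩ : ∃ j, n = 2 * (s + 1) + j := ⟨n - 2 * (s + 1), by omega⟩
    rw [weight_mul_mainTerm_succ]
    rcases Nat.eq_zero_or_pos s with rfl | hs0
    · have : weight (2 * (0 + 1) + j) 0 = 1 := by
        simp [weight, div_self (Nat.cast_ne_zero.mpr (Nat.factorial_ne_zero _) : ((2 + j)! : ℝ) ≠ 0)]
      rw [this]
      simp only [mainTerm, Nat.sub_zero, choose_zero_right, Nat.cast_one, mul_one, one_mul]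
      have hj : (1 : ℝ) ≤ j := by
        have : 1 ≤ j := by omega
        exact_mod_cast this
      have key : ((j : ℝ) + 2) * (j + 1) / (j + 1 / 2) ^ 2 ≤ 1 + 8 / (2 + j) := by
        rw [div_le_iff₀ (by positivity)]
        have e : (1 + 8 / (2 + (j : ℝ))) * (j + 1 / 2) ^ 2 =
            ((10 + j) * (j + 1 / 2) ^ 2) / (2 + j) := by
          field_simp
          ring
        rw [e, le_div_iff₀ (by positivity)]
        nlinarith [mul_nonneg (sub_nonneg.mpr hj) (sub_nonneg.mpr hj)]
      push_cast
      norm_num at key ⊢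
      have hsq : (0 : ℝ) ≤ (numTrees (2 + j) : ℝ) ^ 2 := by positivity
      nlinarith [mul_le_mul_of_nonneg_left key hsq]
    · have hs1 : (1 : ℝ) ≤ s := by exact_mod_cast hs0
      have key : ((j : ℝ) + 2) * (j + 1) / (j + s + 1 / 2) ^ 2 ≤ 1 := by
        rw [div_le_one (by positivity)]
        nlinarith [Nat.cast_nonneg (α := ℝ) j]
      have h0 : 0 ≤ weight (2 * (s + 1) + j) s * mainTerm (2 * (s + 1) + j) s ^ 2 :=
        mul_nonneg (weight_nonneg _ _) (sq_nonneg _)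
      calc _ ≤ weight (2 * (s + 1) + j) s * mainTerm (2 * (s + 1) + j) s ^ 2 *
            (1 / 8 / (s + 1) * 1) := by gcongr
        _ ≤ (1 / 8 : ℝ) ^ s / s ! * (1 + 8 / ((2 * (s + 1) + j : ℕ) : ℝ)) *
            numTrees (2 * (s + 1) + j) ^ 2 * (1 / 8 / (s + 1) * 1) := by gcongr
        _ = _ := by
          rw [factorial_succ]
          push_cast
          field_simp
          ring

end PTree

namespace PTree

open Finset Nat

theorem pow_div_factorial_mono {n k t : ℕ} (hkt : k ≤ t) (ht : t ≤ n) :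
    (n : ℝ) ^ k / k ! ≤ (n : ℝ) ^ t / t ! := by
  induction t, hkt using Nat.le_induction with
  | base => exact le_rfl
  | succ t _ ih =>
    refine (ih (by omega)).trans ?_
    rw [factorial_succ, pow_succ, Nat.cast_mul, mul_comm ((t + 1 : ℕ) : ℝ), mul_div_mul_comm]
    refine le_mul_of_one_le_right (by positivity) ?_
    rw [one_le_div (by positivity)]
    exact_mod_cast ht

theorem pow_div_factorial_le {n k s : ℕ} (hk : k < s) (hs : s ≤ n) :
    (n : ℝ) ^ k / k ! ≤ (n : ℝ) ^ s / s ! * (s / n) := by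
  obtain ⟨t, rfl⟩ : ∃ t, s = t + 1 := ⟨s - 1, by omega⟩
  have hn : (n : ℝ) ≠ 0 := by
    have : n ≠ 0 := by omega
    exact_mod_cast this
  refine (pow_div_factorial_mono (n := n) (Nat.lt_succ_iff.mp hk) (by omega)).trans (le_of_eq ?_)
  rw [factorial_succ]
  push_cast
  field_simp
  ring

theorem sq_le_four_pow (s : ℕ) : s ^ 2 ≤ 4 ^ s := by
  have : s ≤ 2 ^ s := Nat.lt_two_pow_self.le
  calc s ^ 2 ≤ (2 ^ s) ^ 2 := Nat.pow_le_pow_left this 2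
    _ = 4 ^ s := by rw [← pow_mul, mul_comm, pow_mul]; norm_num

theorem sum_autMoved_even_le {n s : ℕ} (hn : 0 < n) (hs : 2 * s ≤ n) :
    ((∑ T ∈ planeTrees n, autMoved T (2 * s) : ℕ) : ℝ) ≤
      mainTerm n s + numTrees n * ((n : ℝ) ^ s / s ! * (256 ^ s / n)) := by
  have h1 : swapCount 1 = 0 := swapCount_odd 1 odd_one
  rw [sum_autMoved hs, ← sum_subset (s₁ := range (s + 1)), sum_range_succ,
    powCoeff_two_mul swapCount_zero h1 swapCount_two, show n - 2 * s + s = n - s by omega,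
    add_comm]
  · push_cast
    rw [mul_one, mainTerm]
    gcongr
    have hterm : ∀ k ∈ range s, ((numTrees (n - 2 * s + k) : ℝ) *
        (((n - 2 * s + k).choose k : ℝ) * powCoeff swapCount (2 * s) k)) ≤
        numTrees n * ((n : ℝ) ^ s / s ! * (s / n) * 64 ^ s) := by
      intro k hk
      rw [mem_range] at hk
      have e1 : (numTrees (n - 2 * s + k) : ℝ) ≤ numTrees n := by
        exact_mod_cast numTrees_mono (by omega)
      have e2 : ((n - 2 * s + k).choose k : ℝ) ≤ (n : ℝ) ^ s / s ! * (s / n) := by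
        refine (Nat.choose_le_pow_div k (n - 2 * s + k)).trans ?_
        refine le_trans ?_ (pow_div_factorial_le hk (by omega))
        gcongr
        omega
      have e3 : (powCoeff swapCount (2 * s) k : ℝ) ≤ 64 ^ s := by
        have := powCoeff_le swapCount_zero swapCount_le (2 * s) k
        rw [pow_mul] at this
        exact_mod_cast this
      gcongr
    refine (sum_le_sum hterm).trans ?_
    rw [sum_const, card_range, nsmul_eq_mul]
    have e4 : ((s : ℝ)) ^ 2 ≤ 4 ^ s := by exact_mod_cast sq_le_four_pow s
    calc (s : ℝ) * (numTrees n * ((n : ℝ) ^ s / s ! * (s / n) * 64 ^ s))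
        = numTrees n * ((n : ℝ) ^ s / s ! * ((s ^ 2 * 64 ^ s) / n)) := by ring
      _ ≤ numTrees n * ((n : ℝ) ^ s / s ! * ((4 ^ s * 64 ^ s) / n)) := by gcongr
      _ = _ := by rw [← mul_pow]; norm_num
  · exact range_subset_range.mpr (by omega)
  · intro k _ hk
    rw [powCoeff_of_lt swapCount_zero h1, mul_zero, mul_zero]
    rw [mem_range] at hk
    omega

theorem sum_autMoved_odd {n m : ℕ} (hm : Odd m) (hmn : m ≤ n) :
    ∑ T ∈ planeTrees n, autMoved T m = 0 := by
  rw [sum_autMoved hmn]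
  exact sum_eq_zero fun k _ => by rw [powCoeff_odd swapCount_odd hm, mul_zero, mul_zero]

theorem pow_le_three_pow_mul_descFactorial {n m : ℕ} (hm : m ≤ n) :
    (n : ℝ) ^ m ≤ 3 ^ m * n.descFactorial m := by
  induction n generalizing m with
  | zero =>
    obtain rfl : m = 0 := by omega
    simp
  | succ n ih =>
    rcases m with _ | m
    · simp
    have hmn : m ≤ n := by omega
    rw [succ_descFactorial_succ]
    have h1 : ((n : ℝ) + 1) ^ m ≤ 3 * (n : ℝ) ^ m := by
      rcases Nat.eq_zero_or_pos n with rfl | hn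
      · obtain rfl : m = 0 := by omega
        norm_num
      have hn' : (0 : ℝ) < n := by exact_mod_cast hn
      have e1 : ((n : ℝ) + 1) = n * (1 / n + 1) := by field_simp; ring
      have e2 : (1 / (n : ℝ) + 1) ^ m ≤ 3 := by
        calc (1 / (n : ℝ) + 1) ^ m ≤ (Real.exp (1 / n)) ^ m := by
              gcongr
              exact Real.add_one_le_exp _
          _ = Real.exp (m * (1 / n)) := by rw [Real.exp_nat_mul]
          _ ≤ Real.exp 1 := by
              apply Real.exp_le_exp.mpr
              rw [mul_one_div, div_le_one hn']
              exact_mod_cast hmn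
          _ ≤ 3 := by linarith [Real.exp_one_lt_d9]
      rw [e1, mul_pow, mul_comm 3]
      gcongr
    have h2 := ih hmn
    push_cast
    calc ((n : ℝ) + 1) ^ (m + 1) = (n + 1) * (n + 1) ^ m := by ring
      _ ≤ (n + 1) * (3 * (3 ^ m * n.descFactorial m)) := by
          gcongr
          exact h1.trans (by gcongr)
      _ = _ := by ring

theorem weight_mul_pow_le {n s : ℕ} (hs : 2 * s ≤ n) :
    weight n s * ((n : ℝ) ^ s / s !) ^ 2 ≤ 18 ^ s / s ! := by
  have h1 := pow_le_three_pow_mul_descFactorial hs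
  have h2 : ((n - 2 * s)! : ℝ) * n.descFactorial (2 * s) = n ! := by
    exact_mod_cast factorial_mul_descFactorial hs
  have h3 : ((n - 2 * s)! : ℝ) * (n : ℝ) ^ (2 * s) ≤ 9 ^ s * n ! := by
    rw [← h2]
    calc ((n - 2 * s)! : ℝ) * (n : ℝ) ^ (2 * s)
        ≤ (n - 2 * s)! * (3 ^ (2 * s) * n.descFactorial (2 * s)) := by gcongr
      _ = _ := by rw [pow_mul]; norm_num; ring
  have hn : (0 : ℝ) < n ! := by exact_mod_cast factorial_pos n
  have hs' : (0 : ℝ) < s ! := by exact_mod_cast factorial_pos s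
  calc weight n s * ((n : ℝ) ^ s / s !) ^ 2
      = ((n - 2 * s)! * (n : ℝ) ^ (2 * s)) * 2 ^ s / (n ! * s !) := by
        rw [weight, mul_comm 2 s, pow_mul]
        field_simp
    _ ≤ (9 ^ s * n !) * 2 ^ s / (n ! * s !) := by gcongr
    _ = 18 ^ s / s ! := by
        rw [show (18 : ℝ) = 9 * 2 by norm_num, mul_pow]
        field_simp

theorem mainTerm_le {n s : ℕ} : mainTerm n s ≤ numTrees n * ((n : ℝ) ^ s / s !) := by
  have e1 : (numTrees (n - s) : ℝ) ≤ numTrees n := by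
    exact_mod_cast numTrees_mono (by omega)
  have e2 : ((n - s).choose s : ℝ) ≤ (n : ℝ) ^ s / s ! := by
    refine (Nat.choose_le_pow_div s (n - s)).trans ?_
    gcongr
    omega
  unfold mainTerm
  gcongr

theorem weight_mul_sq_le {n s : ℕ} (hn : 3 ≤ n) (hs : 2 * s ≤ n) :
    weight n s * ((∑ T ∈ planeTrees n, autMoved T (2 * s) : ℕ) : ℝ) ^ 2 ≤
      (numTrees n : ℝ) ^ 2 * ((1 / 8 : ℝ) ^ s / s ! * (1 + 8 / n) + 3 / n * (1179648 ^ s / s !)) := by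
  have h1 := sum_autMoved_even_le (n := n) (by omega) hs
  have h2 := weight_mul_mainTerm_le hn s hs
  have h3 := mainTerm_le (n := n) (s := s)
  have h4 := weight_mul_pow_le hs
  have h5 := weight_nonneg n s
  have hn0 : (1 : ℝ) ≤ n := by
    have : 1 ≤ n := by omega
    exact_mod_cast this
  set c : ℝ := (numTrees n : ℝ) with hc
  set P : ℝ := (n : ℝ) ^ s / s ! with hP
  have hc0 : 0 ≤ c := by rw [hc]; positivity
  have hP0 : 0 ≤ P := by rw [hP]; positivity
  have hM0 : 0 ≤ mainTerm n s := by unfold mainTerm; positivity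
  have h256 : (1 : ℝ) ≤ 256 ^ s := one_le_pow₀ (by norm_num)
  set q : ℝ := 256 ^ s / n with hq
  have hq0 : 0 ≤ q := by rw [hq]; positivity
  have hq1 : q ≤ 256 ^ s := div_le_self (by positivity) hn0
  calc weight n s * ((∑ T ∈ planeTrees n, autMoved T (2 * s) : ℕ) : ℝ) ^ 2
      ≤ weight n s * (mainTerm n s + c * (P * q)) ^ 2 := by gcongr
    _ = weight n s * mainTerm n s ^ 2 +
        weight n s * (c * P * q * (2 * mainTerm n s + c * P * q)) := by ring
    _ ≤ weight n s * mainTerm n s ^ 2 +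
        weight n s * (c * P * q * (2 * (c * P) + c * P * 256 ^ s)) := by gcongr
    _ = weight n s * mainTerm n s ^ 2 +
        c ^ 2 * (weight n s * P ^ 2) * (256 ^ s * (2 + 256 ^ s) / n) := by rw [hq]; ring
    _ ≤ (1 / 8 : ℝ) ^ s / s ! * (1 + 8 / n) * c ^ 2 +
        c ^ 2 * (18 ^ s / s !) * (256 ^ s * (2 * 256 ^ s + 256 ^ s) / n) := by
        gcongr
        linarith
    _ = _ := by
        rw [show (1179648 : ℝ) = 18 * 256 * 256 by norm_num, mul_pow, mul_pow]
        ring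

theorem sum_symCount_le {n : ℕ} (hn : 3 ≤ n) :
    ∑ T ∈ planeTrees n, ∑ S ∈ planeTrees n, (symCount T S : ℝ) / n ! ≤
      (numTrees n : ℝ) ^ 2 * (truncExp n + (8 * Real.exp (1 / 8) + 3 * Real.exp 1179648) / n) := by
  have h1 : ∑ T ∈ planeTrees n, ∑ S ∈ planeTrees n, symCount T S ≤
      ∑ m ∈ range (n + 1), (n - m)! * m‼ * (∑ T ∈ planeTrees n, autMoved T m) ^ 2 := by
    calc ∑ T ∈ planeTrees n, ∑ S ∈ planeTrees n, symCount T S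
        ≤ ∑ T ∈ planeTrees n, ∑ S ∈ planeTrees n, ∑ m ∈ range (n + 1),
          (n - m)! * m‼ * (autMoved T m * autMoved S m) := by
          refine sum_le_sum fun T hT => sum_le_sum fun S _ => ?_
          have := symCount_le T S
          rwa [mem_planeTrees.mp hT] at this
      _ = _ := by
          simp only [pow_two, sum_mul_sum]
          simp only [mul_sum]
          rw [sum_congr rfl fun T _ => sum_comm, sum_comm]
  have h2 : ∑ m ∈ range (n + 1), (n - m)! * m‼ * (∑ T ∈ planeTrees n, autMoved T m) ^ 2 =
      ∑ s ∈ range (n / 2 + 1), (n - 2 * s)! * (2 ^ s * s !) *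
        (∑ T ∈ planeTrees n, autMoved T (2 * s)) ^ 2 := by
    symm
    refine sum_bij_ne_zero (fun s _ _ => 2 * s) ?_ ?_ ?_ ?_
    · intro s hs _
      rw [mem_range] at hs ⊢
      omega
    · intro s _ _ t _ _ h
      omega
    · intro m hm hne
      rw [mem_range] at hm
      rcases Nat.even_or_odd' m with ⟨s, rfl | h⟩
      · refine ⟨s, mem_range.mpr (by omega), ?_, rfl⟩
        rwa [doubleFactorial_two_mul] at hne
      · exact absurd (by rw [sum_autMoved_odd ⟨s, h⟩ (by omega)]; simp) hne
    · intro s _ _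
      rw [doubleFactorial_two_mul]
  rw [h2] at h1
  have h3 : (∑ T ∈ planeTrees n, ∑ S ∈ planeTrees n, (symCount T S : ℝ)) ≤
      ∑ s ∈ range (n / 2 + 1), ((n - 2 * s)! * (2 ^ s * s !) *
        ((∑ T ∈ planeTrees n, autMoved T (2 * s) : ℕ) : ℝ) ^ 2) := by
    exact_mod_cast h1
  have hfac : (0 : ℝ) < n ! := by exact_mod_cast factorial_pos n
  have hn0 : (0 : ℝ) < n := by
    have : 0 < n := by omega
    exact_mod_cast this
  calc ∑ T ∈ planeTrees n, ∑ S ∈ planeTrees n, (symCount T S : ℝ) / n !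
      = (∑ T ∈ planeTrees n, ∑ S ∈ planeTrees n, (symCount T S : ℝ)) / n ! := by
        simp only [sum_div]
    _ ≤ (∑ s ∈ range (n / 2 + 1), ((n - 2 * s)! * (2 ^ s * s !) *
        ((∑ T ∈ planeTrees n, autMoved T (2 * s) : ℕ) : ℝ) ^ 2)) / n ! := by gcongr
    _ = ∑ s ∈ range (n / 2 + 1), weight n s *
        ((∑ T ∈ planeTrees n, autMoved T (2 * s) : ℕ) : ℝ) ^ 2 := by
        rw [sum_div]
        exact sum_congr rfl fun s _ => by rw [weight]; ring
    _ ≤ ∑ s ∈ range (n / 2 + 1), numTrees n ^ 2 *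
        ((1 / 8 : ℝ) ^ s / s ! * (1 + 8 / n) + 3 / n * (1179648 ^ s / s !)) := by
        refine sum_le_sum fun s hs => weight_mul_sq_le hn ?_
        rw [mem_range] at hs
        omega
    _ = (numTrees n : ℝ) ^ 2 * (truncExp n + (8 * truncExp n +
        3 * ∑ s ∈ range (n / 2 + 1), (1179648 : ℝ) ^ s / s !) / n) := by
        rw [← mul_sum, sum_add_distrib, ← sum_mul, ← mul_sum, truncExp]
        ring
    _ ≤ _ := by
        have e1 : truncExp n ≤ Real.exp (1 / 8) :=
          Real.sum_le_exp_of_nonneg (by norm_num) _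
        have e2 := Real.sum_le_exp_of_nonneg (x := 1179648) (by norm_num) (n / 2 + 1)
        gcongr

end PTree

namespace PTree

open Finset Nat

theorem cherries_le_size : ∀ T : PTree, cherries T ≤ T.size
  | leaf => by simp [cherries]
  | node l r => by
    by_cases h : l = leaf ∧ r = leaf
    · obtain ⟨rfl, rfl⟩ := h
      simp [cherries, size]
    · rw [cherries_node h, size]
      exact Nat.add_le_add (cherries_le_size l) (cherries_le_size r)

theorem pow_sub_pow_le_mul_abs {a b : ℝ} (ha0 : 0 ≤ a) (ha1 : a ≤ 1) (hb0 : 0 ≤ b) (hb1 : b ≤ 1)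
    (s : ℕ) : b ^ s - a ^ s ≤ s * |a - b| := by
  induction s with
  | zero => simp
  | succ s ih =>
    have h1 : b ^ s * (b - a) ≤ |a - b| := by
      calc b ^ s * (b - a) ≤ b ^ s * |a - b| := by
            gcongr
            rw [abs_sub_comm]
            exact le_abs_self _
        _ ≤ 1 * |a - b| := by
            gcongr
            exact pow_le_one₀ hb0 hb1
        _ = _ := one_mul _
    have h2 : a * (b ^ s - a ^ s) ≤ s * |a - b| := by
      calc a * (b ^ s - a ^ s) ≤ a * (s * |a - b|) := by gcongr
        _ ≤ 1 * (s * |a - b|) := by gcongr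
        _ = _ := one_mul _
    push_cast
    calc b ^ (s + 1) - a ^ (s + 1) = b ^ s * (b - a) + a * (b ^ s - a ^ s) := by ring
      _ ≤ _ := by linarith

theorem descFactorial_div_pow_le_one {n c : ℕ} (hc : c ≤ n) (s : ℕ) :
    (c.descFactorial s : ℝ) / (n : ℝ) ^ s ≤ 1 := by
  refine div_le_one_of_le₀ ?_ (by positivity)
  calc (c.descFactorial s : ℝ) ≤ (c : ℝ) ^ s := by exact_mod_cast descFactorial_le_pow c s
    _ ≤ (n : ℝ) ^ s := by gcongr

theorem pow_sub_le_descFactorial_div {n c : ℕ} (hn : 0 < n) (hc : c ≤ n) (s : ℕ) :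
    ((c : ℝ) / n) ^ s - (s : ℝ) ^ 2 / n ≤ (c.descFactorial s : ℝ) / (n : ℝ) ^ s := by
  have hn' : (0 : ℝ) < n := by exact_mod_cast hn
  have hx : (c : ℝ) / n ≤ 1 := div_le_one_of_le₀ (by exact_mod_cast hc) hn'.le
  have hx0 : 0 ≤ (c : ℝ) / n := by positivity
  induction s with
  | zero => simp
  | succ s ih =>
    set d := (c.descFactorial s : ℝ) / (n : ℝ) ^ s with hd
    have hd0 : 0 ≤ d := by rw [hd]; positivity
    have hd1 : d ≤ 1 := descFactorial_div_pow_le_one hc s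
    have h1 : d * ((c : ℝ) / n - s / n) ≤ (c.descFactorial (s + 1) : ℝ) / (n : ℝ) ^ (s + 1) := by
      have h2 : (c : ℝ) - s ≤ ((c - s : ℕ) : ℝ) := by
        rw [sub_le_iff_le_add]
        exact_mod_cast (by omega : c ≤ c - s + s)
      calc d * ((c : ℝ) / n - s / n) = d * ((c - s) / n) := by ring
        _ ≤ d * (((c - s : ℕ) : ℝ) / n) := by gcongr
        _ = _ := by rw [hd, descFactorial_succ, pow_succ, Nat.cast_mul]; field_simp
    refine le_trans ?_ h1
    set x := (c : ℝ) / n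
    have h3 : x * (x ^ s - (s : ℝ) ^ 2 / n) ≤ x * d := by gcongr
    have h4 : x * ((s : ℝ) ^ 2 / n) ≤ (s : ℝ) ^ 2 / n :=
      mul_le_of_le_one_left (by positivity) hx
    have h5 : d * ((s : ℝ) / n) ≤ s / n := mul_le_of_le_one_left (by positivity) hd1
    have h6 : ((s + 1 : ℕ) : ℝ) ^ 2 / n = (s : ℝ) ^ 2 / n + 2 * (s / n) + 1 / n := by
      push_cast
      ring
    have h7 : 0 ≤ (s : ℝ) / n := by positivity
    have h8 : 0 ≤ 1 / (n : ℝ) := by positivity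
    rw [h6, pow_succ]
    nlinarith

/-- The deviation of the proportion of cherries from its limit. -/
noncomputable def cherryDev (n : ℕ) (T : PTree) : ℝ := |(cherries T : ℝ) / n - 1 / 4|

theorem cherryDev_nonneg (n : ℕ) (T : PTree) : 0 ≤ cherryDev n T := abs_nonneg _

theorem pow_sub_descFactorial_mul_le {n c d : ℕ} (hn : 0 < n) (hc : c ≤ n) (hd : d ≤ n) (s : ℕ) :
    (1 / 16 : ℝ) ^ s -
        (c.descFactorial s : ℝ) / (n : ℝ) ^ s * ((d.descFactorial s : ℝ) / (n : ℝ) ^ s) ≤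
      4 ^ s * (|(c : ℝ) / n - 1 / 4| + |(d : ℝ) / n - 1 / 4| + 2 / n) := by
  have hn' : (0 : ℝ) < n := by exact_mod_cast hn
  have hc1 := pow_sub_le_descFactorial_div hn hc s
  have hd1 := pow_sub_le_descFactorial_div hn hd s
  have hc2 := descFactorial_div_pow_le_one hc s
  have hd2 := descFactorial_div_pow_le_one hd s
  have hx1 : (c : ℝ) / n ≤ 1 := div_le_one_of_le₀ (by exact_mod_cast hc) hn'.le
  have hy1 : (d : ℝ) / n ≤ 1 := div_le_one_of_le₀ (by exact_mod_cast hd) hn'.le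
  have hx0 : 0 ≤ (c : ℝ) / n := by positivity
  have hy0 : 0 ≤ (d : ℝ) / n := by positivity
  have hc0 : 0 ≤ (c.descFactorial s : ℝ) / (n : ℝ) ^ s := by positivity
  set u := (c.descFactorial s : ℝ) / (n : ℝ) ^ s
  set v := (d.descFactorial s : ℝ) / (n : ℝ) ^ s
  set x := (c : ℝ) / n
  set y := (d : ℝ) / n
  have h1 := pow_sub_pow_le_mul_abs (a := x * y) (b := 1 / 16) (by positivity)
    (mul_le_one₀ hx1 hy0 hy1) (by norm_num) (by norm_num) s
  have h2 : |x * y - 1 / 16| ≤ |x - 1 / 4| + |y - 1 / 4| := by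
    calc |x * y - 1 / 16| = |(x - 1 / 4) * y + 1 / 4 * (y - 1 / 4)| := by ring_nf
      _ ≤ |x - 1 / 4| * |y| + |(1 / 4 : ℝ)| * |y - 1 / 4| := by
          rw [← abs_mul, ← abs_mul]
          exact abs_add_le _ _
      _ ≤ |x - 1 / 4| * 1 + 1 * |y - 1 / 4| := by
          gcongr
          · rwa [abs_of_nonneg hy0]
          · rw [abs_of_nonneg] <;> norm_num
      _ = _ := by ring
  have h3 : (x * y) ^ s - 2 * (s : ℝ) ^ 2 / n ≤ u * v := by
    have hp : y ^ s ≤ 1 := pow_le_one₀ hy0 hy1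
    have hp0 : 0 ≤ y ^ s := by positivity
    have hq : 0 ≤ (s : ℝ) ^ 2 / n := by positivity
    have e1 : u * (y ^ s - (s : ℝ) ^ 2 / n) ≤ u * v := by gcongr
    have e2 : (x ^ s - (s : ℝ) ^ 2 / n) * y ^ s ≤ u * y ^ s := by gcongr
    have e3 : u * ((s : ℝ) ^ 2 / n) ≤ (s : ℝ) ^ 2 / n := mul_le_of_le_one_left hq hc2
    have e4 : (s : ℝ) ^ 2 / n * y ^ s ≤ (s : ℝ) ^ 2 / n := mul_le_of_le_one_right hq hp
    rw [mul_pow, mul_div_assoc]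
    linarith
  have h4 : (s : ℝ) ≤ 4 ^ s := by exact_mod_cast (Nat.lt_pow_self (by norm_num : 1 < 4)).le
  have h5 : (s : ℝ) ^ 2 ≤ 4 ^ s := by exact_mod_cast sq_le_four_pow s
  have h6 : (s : ℝ) * |x * y - 1 / 16| ≤ 4 ^ s * (|x - 1 / 4| + |y - 1 / 4|) := by gcongr
  have h7 : 2 * (s : ℝ) ^ 2 / n ≤ 4 ^ s * (2 / n) := by
    calc 2 * (s : ℝ) ^ 2 / n ≤ 2 * 4 ^ s / n := by gcongr
      _ = _ := by ring
  rw [mul_add]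
  linarith

theorem le_weight_mul_choose {n c d s : ℕ} (hs : 2 * s ≤ n) :
    2 ^ s / s ! * ((c.descFactorial s : ℝ) / (n : ℝ) ^ s * ((d.descFactorial s : ℝ) / (n : ℝ) ^ s)) ≤
      weight n s * (c.choose s * d.choose s) := by
  rcases Nat.eq_zero_or_pos n with rfl | hn
  · obtain rfl : s = 0 := by omega
    simp [weight]
  have hn' : (0 : ℝ) < n := by exact_mod_cast hn
  have hs' : (0 : ℝ) < s ! := by exact_mod_cast factorial_pos s
  have hf : (0 : ℝ) < n ! := by exact_mod_cast factorial_pos n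
  have h1 : (n ! : ℝ) ≤ (n - 2 * s)! * (n : ℝ) ^ (2 * s) := by
    have : n ! ≤ (n - 2 * s)! * n ^ (2 * s) := by
      rw [← factorial_mul_descFactorial hs]
      exact Nat.mul_le_mul_left _ (descFactorial_le_pow _ _)
    exact_mod_cast this
  have hc : (c.descFactorial s : ℝ) = s ! * c.choose s := by
    exact_mod_cast descFactorial_eq_factorial_mul_choose c s
  have hd : (d.descFactorial s : ℝ) = s ! * d.choose s := by
    exact_mod_cast descFactorial_eq_factorial_mul_choose d s
  rw [hc, hd]
  calc 2 ^ s / s ! * ((s ! * c.choose s : ℝ) / (n : ℝ) ^ s * ((s ! * d.choose s) / (n : ℝ) ^ s))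
      = (n ! * (2 ^ s * s !) / (n ! * (n : ℝ) ^ (2 * s))) * (c.choose s * d.choose s) := by
        rw [mul_comm 2 s, pow_mul]
        field_simp
    _ ≤ ((n - 2 * s)! * (n : ℝ) ^ (2 * s) * (2 ^ s * s !) / (n ! * (n : ℝ) ^ (2 * s))) *
        (c.choose s * d.choose s) := by gcongr
    _ = _ := by
        rw [weight]
        field_simp

theorem sum_weight_mul_choose_le {n : ℕ} {T S : PTree} (hT : T.size = n) (hS : S.size = n) :
    ∑ s ∈ range (n / 2 + 1), weight n s * ((cherries T).choose s * (cherries S).choose s) ≤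
      (symCount T S : ℝ) / n ! := by
  have h1 := le_symCount (hT.trans hS.symm) (n / 2 + 1)
  rw [hT] at h1
  have h2 : ∑ s ∈ range (n / 2 + 1), (n - 2 * s)! * (2 ^ s * s !) *
      ((cherries T).choose s * (cherries S).choose s) ≤ symCount T S := by
    refine le_trans (sum_le_sum fun s _ => ?_) h1
    gcongr <;> exact choose_cherries_le _ _
  have hf : (0 : ℝ) < n ! := by exact_mod_cast factorial_pos n
  rw [le_div_iff₀ hf, sum_mul]
  have h3 : ∑ s ∈ range (n / 2 + 1), ((n - 2 * s)! * (2 ^ s * s !) *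
      ((cherries T).choose s * (cherries S).choose s) : ℝ) ≤ symCount T S := by
    exact_mod_cast h2
  refine le_of_eq_of_le (sum_congr rfl fun s _ => ?_) h3
  rw [weight]
  field_simp

theorem truncExp_sub_le {n : ℕ} (hn : 0 < n) {T S : PTree} (hT : T.size = n) (hS : S.size = n) :
    truncExp n - (symCount T S : ℝ) / n ! ≤
      Real.exp 8 * (cherryDev n T + cherryDev n S + 2 / n) := by
  have h1 := sum_weight_mul_choose_le hT hS
  have hc := (cherries_le_size T).trans_eq hT
  have hd := (cherries_le_size S).trans_eq hS
  have hD : 0 ≤ cherryDev n T + cherryDev n S + 2 / n :=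
    add_nonneg (add_nonneg (cherryDev_nonneg _ _) (cherryDev_nonneg _ _)) (by positivity)
  calc truncExp n - (symCount T S : ℝ) / n !
      ≤ truncExp n - ∑ s ∈ range (n / 2 + 1),
          weight n s * ((cherries T).choose s * (cherries S).choose s) := by gcongr
    _ = ∑ s ∈ range (n / 2 + 1), ((1 / 8 : ℝ) ^ s / (s !) -
          weight n s * ((cherries T).choose s * (cherries S).choose s)) := by
        rw [sum_sub_distrib, truncExp]
    _ ≤ ∑ s ∈ range (n / 2 + 1),
          8 ^ s / s ! * (cherryDev n T + cherryDev n S + 2 / n) := by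
        refine sum_le_sum fun s hs => ?_
        rw [mem_range] at hs
        have h2 := le_weight_mul_choose (n := n) (c := cherries T) (d := cherries S) (s := s)
          (by omega)
        have h3 := pow_sub_descFactorial_mul_le hn hc hd s
        calc _ ≤ (1 / 8 : ℝ) ^ s / (s !) - 2 ^ s / s ! *
              (((cherries T).descFactorial s : ℝ) / (n : ℝ) ^ s *
                (((cherries S).descFactorial s : ℝ) / (n : ℝ) ^ s)) := by gcongr
          _ = 2 ^ s / s ! * ((1 / 16 : ℝ) ^ s - ((cherries T).descFactorial s : ℝ) / (n : ℝ) ^ s *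
                (((cherries S).descFactorial s : ℝ) / (n : ℝ) ^ s)) := by
              rw [show (1 / 8 : ℝ) = 2 * (1 / 16) by norm_num, mul_pow]
              ring
          _ ≤ 2 ^ s / s ! * (4 ^ s * (cherryDev n T + cherryDev n S + 2 / n)) := by
              gcongr
              exact h3
          _ = _ := by
              rw [show (8 : ℝ) = 2 * 4 by norm_num, mul_pow]
              ring
    _ ≤ _ := by
        rw [← sum_mul]
        gcongr
        exact Real.sum_le_exp_of_nonneg (by norm_num) _

theorem one_le_symCount_div {n : ℕ} {T S : PTree} (hT : T.size = n) (hS : S.size = n) :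
    1 ≤ (symCount T S : ℝ) / n ! := by
  have h1 := le_symCount (hT.trans hS.symm) 1
  have hf : (0 : ℝ) < n ! := by exact_mod_cast factorial_pos n
  rw [one_le_div hf, Nat.cast_le]
  refine le_trans ?_ h1
  rw [sum_range_one, hT]
  simp only [mul_zero, Nat.sub_zero, pow_zero, factorial_zero, mul_one]
  exact Nat.le_mul_of_pos_right _
    (Nat.mul_pos (one_le_invCount_zero T) (one_le_invCount_zero S))

theorem sum_cherries_sq_le {n : ℕ} (hn : 4 ≤ n) :
    ∑ T ∈ planeTrees n, ((cherries T : ℝ) - n / 4) ^ 2 ≤ (n : ℝ) * numTrees n := by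
  have h1 := sum_choose_cherries (s := 1) (n := n) (by omega)
  have h2 := sum_choose_cherries (s := 2) (n := n) (by omega)
  have e1 : ∑ T ∈ planeTrees n, (cherries T : ℝ) = numTrees (n - 1) * ((n - 1 : ℕ) : ℝ) := by
    simp only [choose_one_right] at h1
    exact_mod_cast h1
  have e2 : ∑ T ∈ planeTrees n, ((cherries T).choose 2 : ℝ) =
      numTrees (n - 2) * ((n - 2).choose 2 : ℝ) := by exact_mod_cast h2
  have e3 : ∑ T ∈ planeTrees n, ((cherries T : ℝ) - n / 4) ^ 2 =
      2 * ∑ T ∈ planeTrees n, ((cherries T).choose 2 : ℝ) +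
        (1 - (n : ℝ) / 2) * ∑ T ∈ planeTrees n, (cherries T : ℝ) + (n : ℝ) ^ 2 / 16 * numTrees n := by
    rw [mul_sum, mul_sum, numTrees, mul_comm _ ((planeTrees n).card : ℝ), ← nsmul_eq_mul,
      ← sum_const, ← sum_add_distrib, ← sum_add_distrib]
    refine sum_congr rfl fun T _ => ?_
    rw [Nat.cast_choose_two]
    ring
  rw [e3, e1, e2, Nat.cast_choose_two]
  obtain ⟨j, rfl⟩ : ∃ j, n = j + 4 := ⟨n - 4, by omega⟩
  have r1 := numTrees_succ_mul (j + 3) (by omega)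
  have r2 := numTrees_succ_mul (j + 2) (by omega)
  rw [show 2 * (j + 3) - 1 = 2 * j + 5 by omega] at r1
  rw [show 2 * (j + 2) - 1 = 2 * j + 3 by omega] at r2
  rw [show j + 4 - 1 = j + 3 by omega, show j + 4 - 2 = j + 2 by omega]
  have r1 : ((j : ℝ) + 4) * numTrees (j + 4) = 2 * (2 * j + 5) * numTrees (j + 3) := by
    exact_mod_cast r1
  have r2 : ((j : ℝ) + 3) * numTrees (j + 3) = 2 * (2 * j + 3) * numTrees (j + 2) := by
    exact_mod_cast r2
  have q1 : (numTrees (j + 3) : ℝ) = (j + 4) / (2 * (2 * j + 5)) * numTrees (j + 4) := by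
    field_simp
    linarith
  have q2 : (numTrees (j + 2) : ℝ) = (j + 3) / (2 * (2 * j + 3)) * numTrees (j + 3) := by
    field_simp
    linarith
  have hN : (0 : ℝ) ≤ numTrees (j + 4) := by positivity
  rw [q2, q1]
  push_cast
  have key : 2 * ((j + 3) / (2 * (2 * j + 3)) * ((j + 4) / (2 * (2 * j + 5))) *
      (((j : ℝ) + 2) * (j + 2 - 1) / 2)) +
      (1 - ((j : ℝ) + 4) / 2) * ((j + 4) / (2 * (2 * j + 5)) * (j + 3)) +
      ((j : ℝ) + 4) ^ 2 / 16 ≤ j + 4 := by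
    rw [← sub_nonneg]
    have : (j : ℝ) + 4 - (2 * ((j + 3) / (2 * (2 * j + 3)) * ((j + 4) / (2 * (2 * j + 5))) *
      (((j : ℝ) + 2) * (j + 2 - 1) / 2)) +
      (1 - ((j : ℝ) + 4) / 2) * ((j + 4) / (2 * (2 * j + 5)) * (j + 3)) +
      ((j : ℝ) + 4) ^ 2 / 16) =
        (j + 4) * (60 * j ^ 2 + 241 * j + 228) / (16 * (2 * j + 3) * (2 * j + 5)) := by
      field_simp
      ring
    rw [this]
    positivity
  calc _ = (2 * ((j + 3) / (2 * (2 * j + 3)) * ((j + 4) / (2 * (2 * j + 5))) *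
      (((j : ℝ) + 2) * (j + 2 - 1) / 2)) +
      (1 - ((j : ℝ) + 4) / 2) * ((j + 4) / (2 * (2 * j + 5)) * (j + 3)) +
      ((j : ℝ) + 4) ^ 2 / 16) * numTrees (j + 4) := by ring
    _ ≤ _ := by gcongr

theorem sum_cherryDev_le {n : ℕ} (hn : 4 ≤ n) :
    ∑ T ∈ planeTrees n, cherryDev n T ≤ numTrees n * (1 / √n) := by
  have hn0 : (0 : ℝ) < n := by
    have : 0 < n := by omega
    exact_mod_cast this
  have hq : 0 < √(n : ℝ) := Real.sqrt_pos.mpr hn0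
  have hqq : √(n : ℝ) ^ 2 = n := Real.sq_sqrt hn0.le
  have h1 := sum_cherries_sq_le hn
  have h2 : ∀ T, cherryDev n T ≤
      ((cherries T : ℝ) - n / 4) ^ 2 * (1 / (2 * n * √n)) + 1 / (2 * √n) := by
    intro T
    set u := (cherries T : ℝ) / n - 1 / 4 with hu
    have e1 : ((cherries T : ℝ) - n / 4) ^ 2 * (1 / (2 * n * √n)) = √n * u ^ 2 / 2 := by
      rw [hu]
      field_simp
      rw [hqq]
      ring
    have e2 : √(n : ℝ) * u ^ 2 / 2 + 1 / (2 * √n) - |u| = (√n * |u| - 1) ^ 2 / (2 * √n) := by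
      rw [← sq_abs u]
      field_simp
      ring
    have e3 : 0 ≤ (√n * |u| - 1) ^ 2 / (2 * √(n : ℝ)) := by positivity
    rw [e1, cherryDev]
    linarith
  calc ∑ T ∈ planeTrees n, cherryDev n T
      ≤ ∑ T ∈ planeTrees n,
        (((cherries T : ℝ) - n / 4) ^ 2 * (1 / (2 * n * √n)) + 1 / (2 * √n)) :=
        sum_le_sum fun T _ => h2 T
    _ = (∑ T ∈ planeTrees n, ((cherries T : ℝ) - n / 4) ^ 2) * (1 / (2 * n * √n)) +
        numTrees n * (1 / (2 * √n)) := by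
        rw [sum_add_distrib, ← sum_mul, sum_const, nsmul_eq_mul, numTrees]
    _ ≤ (n * numTrees n) * (1 / (2 * n * √n)) + numTrees n * (1 / (2 * √n)) := by gcongr
    _ = _ := by
        field_simp
        ring

end PTree

open Finset in
/-- If the weights `X` are on average close to a constant `γ`, then the probability measure on `P`
with weights `X` is close to the uniform measure. -/
theorem abs_sum_div_sum_sub_card_div_card_le {ι : Type*} {P A : Finset ι} (hA : A ⊆ P)
    (hP : P.Nonempty) {X η : ι → ℝ} {γ κ τ : ℝ} (hX : ∀ p ∈ P, 1 ≤ X p)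
    (hη : ∀ p ∈ P, γ - X p ≤ η p) (hη0 : ∀ p ∈ P, 0 ≤ η p)
    (hsum : ∑ p ∈ P, X p ≤ P.card * (γ + κ)) (hsumη : ∑ p ∈ P, η p ≤ P.card * τ) :
    |(∑ p ∈ A, X p) / (∑ p ∈ P, X p) - (A.card : ℝ) / P.card| ≤ 2 * (κ + 2 * τ) := by
  have hN : (0 : ℝ) < P.card := by exact_mod_cast hP.card_pos
  have hNW : (P.card : ℝ) ≤ ∑ p ∈ P, X p := by
    simpa using Finset.card_nsmul_le_sum P X 1 hX
  have hkN : (A.card : ℝ) ≤ P.card := by exact_mod_cast card_le_card hA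
  have hD : ∑ p ∈ P, |X p - γ| ≤ P.card * (κ + 2 * τ) := by
    calc ∑ p ∈ P, |X p - γ| ≤ ∑ p ∈ P, (X p - γ + 2 * η p) := by
          refine sum_le_sum fun p hp => abs_le.mpr ⟨?_, ?_⟩ <;> linarith [hη p hp, hη0 p hp]
      _ = ∑ p ∈ P, X p - P.card * γ + 2 * ∑ p ∈ P, η p := by
          rw [sum_add_distrib, sum_sub_distrib, sum_const, nsmul_eq_mul, mul_sum]
      _ ≤ _ := by linarith
  have hdev : ∀ B ⊆ P, |∑ p ∈ B, X p - B.card * γ| ≤ ∑ p ∈ P, |X p - γ| := by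
    intro B hB
    calc |∑ p ∈ B, X p - B.card * γ| = |∑ p ∈ B, (X p - γ)| := by
          rw [sum_sub_distrib, sum_const, nsmul_eq_mul]
      _ ≤ ∑ p ∈ B, |X p - γ| := abs_sum_le_sum_abs _ _
      _ ≤ _ := sum_le_sum_of_subset_of_nonneg hB fun _ _ _ => abs_nonneg _
  have h1 := hdev A hA
  have h2 := hdev P subset_rfl
  set a := ∑ p ∈ A, X p
  set W := ∑ p ∈ P, X p
  set D := ∑ p ∈ P, |X p - γ|
  have hW : 0 < W := hN.trans_le hNW
  have hD0 : 0 ≤ D := (abs_nonneg _).trans h2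
  have e : a / W - (A.card : ℝ) / P.card =
      ((a - A.card * γ) - (A.card : ℝ) / P.card * (W - P.card * γ)) / W := by
    field_simp
    ring
  have hr : (A.card : ℝ) / P.card ≤ 1 := div_le_one_of_le₀ hkN hN.le
  rw [e, abs_div, abs_of_pos hW, div_le_iff₀ hW]
  calc |(a - A.card * γ) - (A.card : ℝ) / P.card * (W - P.card * γ)|
      ≤ |a - A.card * γ| + |(A.card : ℝ) / P.card * (W - P.card * γ)| := abs_sub _ _
    _ ≤ D + 1 * D := by
        rw [abs_mul, abs_of_nonneg (by positivity : 0 ≤ (A.card : ℝ) / P.card)]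
        gcongr
    _ = 2 * D := by ring
    _ ≤ 2 * (P.card * (κ + 2 * τ)) := by gcongr
    _ = 2 * (κ + 2 * τ) * P.card := by ring
    _ ≤ 2 * (κ + 2 * τ) * W := by
        have : 0 ≤ κ + 2 * τ := by
          by_contra hneg
          nlinarith [mul_pos hN (neg_pos.mpr (not_le.mp hneg))]
        gcongr

namespace PTree

open Finset Nat

theorem nuT_eq (n : ℕ) (S : Finset (PTree × PTree)) :
    nuT n S = (∑ p ∈ (planeTrees n ×ˢ planeTrees n).filter fun p => (normalize p.1, normalize p.2) ∈ S,
        (symCount p.1 p.2 : ℝ) / n !) /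
      ∑ p ∈ planeTrees n ×ˢ planeTrees n, (symCount p.1 p.2 : ℝ) / n ! := by
  have h1 := card_tangleClasses_filter n (fun p => (normalize p.1, normalize p.2) ∈ S)
    fun T U T' U' hT hU h => by
      rw [← hT.normalize_eq, ← hU.normalize_eq]
      exact h
  have h2 : ((tangleClasses n).card : ℝ) =
      (∑ p ∈ planeTrees n ×ˢ planeTrees n, (symCount p.1 p.2 : ℝ)) / 4 ^ (n - 1) := by
    have h := card_tangleClasses_filter n (fun _ => True) fun _ _ _ _ _ _ _ => trivial
    rw [filter_true] at h
    rw [← h]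
    congr 2
    symm
    ext c
    simp only [mem_filter, and_true, and_iff_left_iff_imp]
    exact nonempty_of_mem_tangleClasses
  have hf : (n ! : ℝ) ≠ 0 := by exact_mod_cast factorial_ne_zero n
  rw [nuT, tangleProb, numTanglegrams, h1, h2, ← sum_div, ← sum_div,
    div_div_div_cancel_right₀ (by positivity), div_div_div_cancel_right₀ hf]
  congr!

theorem sum_product_cherryDev_le {n : ℕ} (hn : 4 ≤ n) :
    ∑ p ∈ planeTrees n ×ˢ planeTrees n,
      Real.exp 8 * (cherryDev n p.1 + cherryDev n p.2 + 2 / n) ≤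
      ((planeTrees n ×ˢ planeTrees n).card : ℝ) * (Real.exp 8 * (2 * (1 / √n) + 2 / n)) := by
  have h := sum_cherryDev_le hn
  rw [← mul_sum, sum_product]
  simp only [sum_add_distrib, sum_const, nsmul_eq_mul, ← mul_sum]
  rw [card_product]
  change _ * (((numTrees n : ℕ) : ℝ) * _ + (numTrees n : ℝ) * _ +
    (numTrees n : ℝ) * ((numTrees n : ℝ) * _)) ≤ ((numTrees n * numTrees n : ℕ) : ℝ) * _
  push_cast
  calc Real.exp 8 * ((numTrees n : ℝ) * ∑ T ∈ planeTrees n, cherryDev n T +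
        numTrees n * ∑ T ∈ planeTrees n, cherryDev n T + numTrees n * (numTrees n * (2 / n)))
      ≤ Real.exp 8 * ((numTrees n : ℝ) * (numTrees n * (1 / √n)) +
        numTrees n * (numTrees n * (1 / √n)) + numTrees n * (numTrees n * (2 / n))) := by gcongr
    _ = _ := by ring

theorem abs_nuT_sub_nuP_le {n : ℕ} (hn : 4 ≤ n) (S : Finset (PTree × PTree)) :
    |nuT n S - nuP n S| ≤ 2 * ((8 * Real.exp (1 / 8) + 3 * Real.exp 1179648) / n +
      2 * (Real.exp 8 * (2 * (1 / √n) + 2 / n))) := by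
  have hcard : ((planeTrees n ×ˢ planeTrees n).card : ℝ) = (numTrees n : ℝ) ^ 2 := by
    rw [card_product, numTrees]
    push_cast
    ring
  have hmem : ∀ p ∈ planeTrees n ×ˢ planeTrees n, p.1.size = n ∧ p.2.size = n := by
    intro p hp
    rw [mem_product, mem_planeTrees, mem_planeTrees] at hp
    exact hp
  have hne : (planeTrees n).Nonempty := card_pos.mp (numTrees_pos (by omega))
  have key := abs_sum_div_sum_sub_card_div_card_le
    (filter_subset (fun p => (normalize p.1, normalize p.2) ∈ S) (planeTrees n ×ˢ planeTrees n))
    (hne.product hne) (X := fun p => (symCount p.1 p.2 : ℝ) / n !)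
    (η := fun p => Real.exp 8 * (cherryDev n p.1 + cherryDev n p.2 + 2 / n)) (γ := truncExp n)
    (fun p hp => one_le_symCount_div (hmem p hp).1 (hmem p hp).2)
    (fun p hp => truncExp_sub_le (by omega) (hmem p hp).1 (hmem p hp).2)
    (fun p _ => mul_nonneg (Real.exp_pos 8).le (add_nonneg
      (add_nonneg (cherryDev_nonneg _ _) (cherryDev_nonneg _ _)) (by positivity)))
    (by rw [hcard, sum_product]; exact sum_symCount_le (by omega))
    (sum_product_cherryDev_le hn)
  rw [hcard] at key
  rw [nuT_eq, nuP]
  exact key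

theorem tvDist_nonneg (n : ℕ) : 0 ≤ tvDist n :=
  (abs_nonneg _).trans (le_sup' (fun S => |nuT n S - nuP n S|) (empty_mem_powerset _))

end PTree

open PTree Filter Asymptotics in
/-- Theorem 1 (first part): the total variation distance between the two-tree
distribution of a random tanglegram and that of two independent random plane
binary trees is `O(n^(-1/2))`. -/
theorem tvDist_nuT_nuP_isBigO :
    (fun n : ℕ => tvDist n) =O[atTop] fun n : ℕ => (n : ℝ) ^ (-(1 / 2) : ℝ) := by
  refine IsBigO.of_bound (2 * ((8 * Real.exp (1 / 8) + 3 * Real.exp 1179648) +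
      2 * (Real.exp 8 * (2 * 1 + 2)))) ?_
  filter_upwards [eventually_ge_atTop 4] with n hn
  have hn1 : (1 : ℝ) ≤ n := by
    have : 1 ≤ n := by omega
    exact_mod_cast this
  have hsqrt : (n : ℝ) ^ (-(1 / 2) : ℝ) = 1 / √n := by
    rw [Real.rpow_neg (by positivity), Real.sqrt_eq_rpow, one_div (_ ^ _)]
  have hle : 1 / (n : ℝ) ≤ 1 / √n :=
    one_div_le_one_div_of_le (Real.sqrt_pos.mpr (by linarith)) (Real.sqrt_le_self_iff.mpr (Or.inr hn1))
  rw [hsqrt, Real.norm_of_nonneg (tvDist_nonneg n), Real.norm_of_nonneg (by positivity)]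
  refine Finset.sup'_le _ _ fun S _ => (abs_nuT_sub_nuP_le hn S).trans ?_
  set C := 8 * Real.exp (1 / 8) + 3 * Real.exp 1179648
  have hC : 0 ≤ C := by positivity
  calc 2 * (C / n + 2 * (Real.exp 8 * (2 * (1 / √n) + 2 / n)))
      = 2 * (C * (1 / n) + 2 * (Real.exp 8 * (2 * (1 / √n) + 2 * (1 / n)))) := by ring
    _ ≤ 2 * (C * (1 / √n) + 2 * (Real.exp 8 * (2 * (1 / √n) + 2 * (1 / √n)))) := by gcongr
    _ = _ := by ring
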